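/- In the Siegel setup, if x₀ and x₁ are two fixed points of the action of Γ and their respective Siegel open sets Φ₀(ℳ₀) and Φ₁(ℳ₁) have nonempty intersection, then these two Siegel open sets are equal. -/

import Mathlib

open Set Filter Topology MeasureTheory Matrix Function
noncomputable section
namespace Zeghib

/-- `ℝⁿ` (with the sup norm; the choice of norm is irrelevant). -/
abbrev V (n : ℕ) : Type := Fin n → ℝ

abbrev SLR (n : ℕ) := Matrix.SpecialLinearGroup (Fin n) ℝ
abbrev SLZ (n : ℕ) := Matrix.SpecialLinearGroup (Fin n) ℤ

/-- The topology on `SL(n,ℝ)` induced from the space of matrices. -/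
instance {n : ℕ} : TopologicalSpace (SLR n) :=
  TopologicalSpace.induced (fun g => (g : Matrix (Fin n) (Fin n) ℝ)) inferInstance

/-- The linear action of `SL(n,ℝ)` on `ℝⁿ`. -/
def lact {n : ℕ} (γ : SLR n) (u : V n) : V n := (γ : Matrix (Fin n) (Fin n) ℝ).mulVec u

lemma lact_mul {n : ℕ} (A B : SLR n) (v : V n) : lact (A * B) v = lact A (lact B v) := by
  simp only [lact, Matrix.SpecialLinearGroup.coe_mul]
  rw [Matrix.mulVec_mulVec]

lemma lact_one {n : ℕ} (v : V n) : lact (1 : SLR n) v = v := by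
  simp [lact]

/-- The coefficient-wise embedding `SL(n,ℤ) →* SL(n,ℝ)`. -/
def slCast {n : ℕ} : SLZ n →* SLR n := Matrix.SpecialLinearGroup.map (Int.castRingHom ℝ)

/-- `SL(n,ℤ)` viewed as a subgroup of `SL(n,ℝ)`. -/
def SLZR (n : ℕ) : Subgroup (SLR n) := MonoidHom.range (slCast (n := n))

/-- A subgroup `Δ` of a topological group `G` is a lattice if it is discrete and the
quotient `G ⧸ Δ` carries a nonzero finite `G`-invariant (Borel) measure. -/
def IsLatticeIn (G : Type*) [Group G] [TopologicalSpace G] (Δ : Subgroup G) : Prop :=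
  DiscreteTopology Δ ∧
    letI : MeasurableSpace (G ⧸ Δ) := borel _
    ∃ μ : Measure (G ⧸ Δ), μ ≠ 0 ∧ IsFiniteMeasure μ ∧
      ∀ g : G, Measure.map (fun x => g • x) μ = μ

/-- `Γ ≤ SL(n,ℝ)` is, up to an automorphism of (the topological group) `SL(n,ℝ)`,
a finite-index subgroup of `SL(n,ℤ)`. -/
def UpToAutoFiniteIndexSLZ {n : ℕ} (Γ : Subgroup (SLR n)) : Prop :=
  ∃ σ : SLR n ≃* SLR n, Continuous σ ∧ Continuous σ.symm ∧
    Γ.map σ.toMonoidHom ≤ SLZR n ∧ ((Γ.map σ.toMonoidHom).subgroupOf (SLZR n)).FiniteIndex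

section Charted

variable (E : Type*) [NormedAddCommGroup E] [NormedSpace ℝ E]
variable (E' : Type*) [NormedAddCommGroup E'] [NormedSpace ℝ E']
variable {M : Type*} [TopologicalSpace M] [ChartedSpace E M]
variable {M' : Type*} [TopologicalSpace M'] [ChartedSpace E' M']

/-- A map between charted spaces (over real normed vector spaces) is real analytic at a
point if it is continuous there and its representative in the preferred charts is
real analytic. -/
def CAnalyticAt (f : M → M') (x : M) : Prop :=
  ContinuousAt f x ∧
    AnalyticAt ℝ ((chartAt E' (f x)) ∘ f ∘ (chartAt E x).symm) (chartAt E x x)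

def CAnalyticOn (f : M → M') (s : Set M) : Prop := ∀ x ∈ s, CAnalyticAt E E' f x

def CAnalytic (f : M → M') : Prop := ∀ x, CAnalyticAt E E' f x

/-- A charted space is a real analytic manifold when all its transition maps are
real analytic. -/
def AnalyticCharts (M : Type*) [TopologicalSpace M] [ChartedSpace E M] : Prop :=
  ∀ x y : M, ∀ z ∈ ((chartAt E x).symm.trans (chartAt E y)).source,
    AnalyticAt ℝ ((chartAt E y) ∘ (chartAt E x).symm) z

/-- `f` is, on `s`, a local analytic diffeomorphism (onto its image). -/
def LocalAnaDiffeoOn (f : M → M') (s : Set M) : Prop :=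
  ∀ x ∈ s, ∃ U : Set M, IsOpen U ∧ x ∈ U ∧ U ⊆ s ∧ InjOn f U ∧ IsOpen (f '' U) ∧
    CAnalyticOn E E' f U ∧ ∃ g : M' → M, LeftInvOn g f U ∧ CAnalyticOn E' E g (f '' U)

/-- `f` restricted to `s` is a covering map onto its image. -/
def IsCoveringOntoImage (f : M → M') (s : Set M) : Prop :=
  ∀ y ∈ f '' s, ∃ W : Set M', IsOpen W ∧ y ∈ W ∧
    ∃ (ι : Type) (U : ι → Set M), (∀ i, IsOpen (U i)) ∧
      Pairwise (Function.onFun Disjoint U) ∧ (s ∩ f ⁻¹' W = ⋃ i, U i) ∧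
      ∀ i, BijOn f (U i) W

/-- An equivalence which is a real analytic diffeomorphism. -/
def IsAnaDiffeo (h : M ≃ M') : Prop := CAnalytic E E' h ∧ CAnalytic E' E h.symm

end Charted

/-- Star-shapedness with respect to the origin. -/
def StarShapedZero {n : ℕ} (s : Set (V n)) : Prop :=
  ∀ u ∈ s, ∀ t ∈ Icc (0:ℝ) 1, t • u ∈ s

/-- `φ` extends, from a neighborhood of `0`, to an analytic local diffeomorphism
(onto its image) defined on `s`. -/
def ExtendsAsLocalAnaDiffeo {n : ℕ} {M : Type*} [TopologicalSpace M] [ChartedSpace (V n) M]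
    (φ : V n → M) (s : Set (V n)) : Prop :=
  ∃ ψ : V n → M, (∀ᶠ u in 𝓝 (0 : V n), ψ u = φ u) ∧ LocalAnaDiffeoOn (V n) (V n) ψ s

/-- `(ℳ, Φ)` is an extension of the germ of the linearizing map `φ` to a connected
`r`-invariant open neighborhood `ℳ` of `0`, as an analytic local diffeomorphism
semi-conjugating the linear action `r` to the action `ρ`. -/
def GoodExt {n : ℕ} {Γ : Type*} {M : Type*} [TopologicalSpace M] [ChartedSpace (V n) M]
    (r : Γ → V n → V n) (ρ : Γ → M → M) (φ : V n → M)
    (ℳ : Set (V n)) (Φ : V n → M) : Prop :=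
  IsOpen ℳ ∧ IsConnected ℳ ∧ (0 : V n) ∈ ℳ ∧
  (∀ γ, ∀ u ∈ ℳ, r γ u ∈ ℳ) ∧
  (∀ᶠ u in 𝓝 (0 : V n), Φ u = φ u) ∧
  LocalAnaDiffeoOn (V n) (V n) Φ ℳ ∧
  (∀ γ, ∀ u ∈ ℳ, Φ (r γ u) = ρ γ (Φ u))

/-- `φ` is an analytic diffeomorphism from an open neighborhood of `0 ∈ ℝⁿ` onto an open
neighborhood of its image, sending `0` to `x₀`. -/
def IsLocalLinearization {n : ℕ} {M : Type*} [TopologicalSpace M] [ChartedSpace (V n) M]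
    (φ : V n → M) (x₀ : M) : Prop :=
  φ 0 = x₀ ∧
  ∃ U : Set (V n), IsOpen U ∧ (0 : V n) ∈ U ∧ InjOn φ U ∧ IsOpen (φ '' U) ∧
    CAnalyticOn (V n) (V n) φ U ∧
    ∃ ψ : M → V n, LeftInvOn ψ φ U ∧ CAnalyticOn (V n) (V n) ψ (φ '' U)

/-- The Siegel setup: `Γ ≤ SL(n,ℝ)` acts analytically on the `n`-manifold `M` fixing `x₀`,
the infinitesimal representation at `x₀` is the canonical one, `φ` linearizes the action
near `x₀` (so that `φ ∘ γ = ρ(γ) ∘ φ` near `0`), and `(ℳ, Φ)` is a maximal extension of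
`φ` to a connected invariant open subset of `ℝⁿ`, as an analytic local diffeomorphism
semi-conjugating the linear action to `ρ`. -/
def SiegelData {n : ℕ} (Γ : Subgroup (SLR n)) {M : Type*} [TopologicalSpace M]
    [ChartedSpace (V n) M] (ρ : Γ →* Equiv.Perm M) (x₀ : M) (φ : V n → M)
    (ℳ : Set (V n)) (Φ : V n → M) : Prop :=
  (∀ γ : Γ, ρ γ x₀ = x₀) ∧
  IsLocalLinearization φ x₀ ∧
  (∀ γ : Γ, ∀ᶠ u in 𝓝 (0 : V n), φ (lact (γ : SLR n) u) = ρ γ (φ u)) ∧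
  GoodExt (fun γ : Γ => lact (γ : SLR n)) (fun γ : Γ => ⇑(ρ γ)) φ ℳ Φ ∧
  (∀ (ℳ' : Set (V n)) (Φ' : V n → M),
    GoodExt (fun γ : Γ => lact (γ : SLR n)) (fun γ : Γ => ⇑(ρ γ)) φ ℳ' Φ' →
    ℳ ⊆ ℳ' → ℳ' = ℳ)

lemma isInducing_coe (n : ℕ) :
    IsInducing (fun g : SLR n => (g : Matrix (Fin n) (Fin n) ℝ)) := ⟨rfl⟩

instance (n : ℕ) : IsTopologicalGroup (SLR n) where
  continuous_mul := by
    rw [(isInducing_coe n).continuous_iff]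
    simp only [Function.comp_def, Matrix.SpecialLinearGroup.coe_mul]
    exact ((isInducing_coe n).continuous.comp continuous_fst).mul
      ((isInducing_coe n).continuous.comp continuous_snd)
  continuous_inv := by
    rw [(isInducing_coe n).continuous_iff]
    simp only [Function.comp_def, Matrix.SpecialLinearGroup.coe_inv]
    exact (isInducing_coe n).continuous.matrix_adjugate

instance (n : ℕ) : SecondCountableTopology (SLR n) := by
  have : SecondCountableTopology (Matrix (Fin n) (Fin n) ℝ) :=
    inferInstanceAs (SecondCountableTopology (Fin n → Fin n → ℝ))
  exact (isInducing_coe n).secondCountableTopology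

/-- Recurrence of the powers of every element of `SL(n,ℝ)` modulo `Γ`. -/
def Recurrent {n : ℕ} (Γ : Subgroup (SLR n)) : Prop :=
  ∀ a : SLR n, ∃ (g g' : ℕ → SLR n) (κ : ℕ → ℕ) (γ : ℕ → Γ),
    Tendsto g atTop (𝓝 1) ∧ Tendsto g' atTop (𝓝 1) ∧ Tendsto κ atTop atTop ∧
    ∀ j, (γ j : SLR n) = (g' j)⁻¹ * a ^ κ j * g j

lemma recurrent_step {n : ℕ} {Γ : Subgroup (SLR n)} (hlat : IsLatticeIn (SLR n) Γ)
    (a : SLR n) (N : ℕ) (O : Set (SLR n)) (hO : IsOpen O) (h1 : (1 : SLR n) ∈ O) :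
    ∃ g ∈ O, ∃ g' ∈ O, ∃ k : ℕ, N ≤ k ∧ (g')⁻¹ * a ^ k * g ∈ Γ := by
  obtain ⟨-, μ, hμ, hfin, hinv⟩ := hlat
  let _ : MeasurableSpace (SLR n ⧸ Γ) := borel _
  have : BorelSpace (SLR n ⧸ Γ) := ⟨rfl⟩
  have hcont : ∀ g : SLR n, Continuous (fun x : SLR n ⧸ Γ => g • x) :=
    fun g => continuous_const_smul g
  have hmp : ∀ g : SLR n, MeasurePreserving (fun x : SLR n ⧸ Γ => g • x) μ μ :=
    fun g => ⟨(hcont g).measurable, hinv g⟩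
  let π : SLR n → SLR n ⧸ Γ := QuotientGroup.mk
  have hW : IsOpen (π '' O) := QuotientGroup.isOpenMap_coe _ hO
  have hpos : μ (π '' O) ≠ 0 := by
    intro h0
    apply hμ
    obtain ⟨D, hDc, hDd⟩ := TopologicalSpace.exists_countable_dense (SLR n)
    rw [← Measure.measure_univ_eq_zero]
    have hcov : (univ : Set (SLR n ⧸ Γ)) ⊆ ⋃ d ∈ D, (fun x : SLR n ⧸ Γ => d⁻¹ • x) ⁻¹' (π '' O) := by
      intro x _
      obtain ⟨y, rfl⟩ := QuotientGroup.mk_surjective x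
      have ho : IsOpen ((fun d : SLR n => d⁻¹ * y) ⁻¹' O) :=
        hO.preimage (by fun_prop)
      obtain ⟨d, hd, hdD⟩ := hDd.inter_open_nonempty _ ho ⟨y, by simpa using h1⟩
      simp only [mem_iUnion]
      exact ⟨d, hdD, ⟨d⁻¹ * y, hd, rfl⟩⟩
    refine measure_mono_null hcov ((measure_biUnion_null_iff hDc).2 fun d _ => ?_)
    rw [(hmp d⁻¹).measure_preimage hW.measurableSet.nullMeasurableSet, h0]
  obtain ⟨x, ⟨g, hg, rfl⟩, m, hm, hxm⟩ :=
    (hmp (a ^ (N + 1))).exists_mem_iterate_mem hW.measurableSet.nullMeasurableSet hpos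
  obtain ⟨g', hg', he⟩ := hxm
  refine ⟨g, hg, g', hg', (N + 1) * m, ?_, ?_⟩
  · nlinarith [Nat.pos_of_ne_zero hm]
  · have : ((fun x : SLR n ⧸ Γ => a ^ (N + 1) • x)^[m]) (π g) = π (a ^ ((N + 1) * m) * g) := by
      rw [smul_iterate, pow_mul]; rfl
    rw [this] at he
    rw [mul_assoc]
    exact QuotientGroup.eq.1 he

lemma IsLatticeIn.recurrent {n : ℕ} {Γ : Subgroup (SLR n)} (hlat : IsLatticeIn (SLR n) Γ) :
    Recurrent Γ := by
  intro a
  obtain ⟨O, hO⟩ := (𝓝 (1 : SLR n)).exists_antitone_basis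
  have : ∀ j : ℕ, ∃ g ∈ O j, ∃ g' ∈ O j, ∃ k : ℕ, j ≤ k ∧ (g')⁻¹ * a ^ k * g ∈ Γ := by
    intro j
    obtain ⟨U, hU, hUo, h1⟩ := mem_nhds_iff.1 (hO.1.mem_of_mem (i := j) trivial)
    obtain ⟨g, hg, g', hg', k, hk, h⟩ := recurrent_step hlat a j U hUo h1
    exact ⟨g, hU hg, g', hU hg', k, hk, h⟩
  choose g hg g' hg' κ hκ hγ using this
  exact ⟨g, g', κ, fun j => ⟨_, hγ j⟩, hO.tendsto hg, hO.tendsto hg',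
    tendsto_atTop_mono hκ tendsto_id, fun j => rfl⟩

/-- The linear action of `g ∈ SL(n,ℝ)` as a continuous linear map. -/
def act {n : ℕ} (g : SLR n) : V n →L[ℝ] V n :=
  LinearMap.toContinuousLinearMap (Matrix.toLin' (g : Matrix (Fin n) (Fin n) ℝ))

@[simp] lemma act_apply {n : ℕ} (g : SLR n) (x : V n) : act g x = lact g x := rfl

lemma continuous_act (n : ℕ) : Continuous (act : SLR n → V n →L[ℝ] V n) := by
  let A : Matrix (Fin n) (Fin n) ℝ →ₗ[ℝ] (V n →L[ℝ] V n) :=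
    LinearMap.toContinuousLinearMap.toLinearMap ∘ₗ (Matrix.toLin').toLinearMap
  exact (LinearMap.continuous_of_finiteDimensional A).comp (isInducing_coe n).continuous

@[simp] lemma act_one {n : ℕ} : act (1 : SLR n) = ContinuousLinearMap.id ℝ (V n) := by
  ext1 x; simp [lact_one]

lemma lact_inv_lact {n : ℕ} (g : SLR n) (x : V n) : lact g⁻¹ (lact g x) = x := by
  rw [← lact_mul, inv_mul_cancel, lact_one]

lemma lact_lact_inv {n : ℕ} (g : SLR n) (x : V n) : lact g (lact g⁻¹ x) = x := by
  rw [← lact_mul, mul_inv_cancel, lact_one]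

lemma lact_smul {n : ℕ} (g : SLR n) (c : ℝ) (x : V n) : lact g (c • x) = c • lact g x :=
  (act g).map_smul c x

lemma lact_add {n : ℕ} (g : SLR n) (x y : V n) : lact g (x + y) = lact g x + lact g y :=
  (act g).map_add x y

lemma tendsto_act {n : ℕ} {ι : Type*} {l : Filter ι} {g : ι → SLR n} {a : SLR n}
    (hg : Tendsto g l (𝓝 a)) : Tendsto (fun i => act (g i)) l (𝓝 (act a)) :=
  ((continuous_act n).tendsto a).comp hg

lemma tendsto_lact {n : ℕ} {ι : Type*} {l : Filter ι} {g : ι → SLR n} {a : SLR n}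
    {x : ι → V n} {y : V n} (hg : Tendsto g l (𝓝 a)) (hx : Tendsto x l (𝓝 y)) :
    Tendsto (fun i => lact (g i) (x i)) l (𝓝 (lact a y)) :=
  ((isBoundedBilinearMap_apply (𝕜 := ℝ) (E := V n) (F := V n)).continuous.tendsto (act a, y)).comp
    ((tendsto_act hg).prodMk_nhds hx)

lemma tendsto_lact_one {n : ℕ} {ι : Type*} {l : Filter ι} {g : ι → SLR n}
    {x : ι → V n} {y : V n} (hg : Tendsto g l (𝓝 1)) (hx : Tendsto x l (𝓝 y)) :
    Tendsto (fun i => lact (g i) (x i)) l (𝓝 y) := by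
  simpa [lact_one] using tendsto_lact hg hx

lemma tendsto_inv_one {n : ℕ} {ι : Type*} {l : Filter ι} {g : ι → SLR n}
    (hg : Tendsto g l (𝓝 1)) : Tendsto (fun i => (g i)⁻¹) l (𝓝 1) := by
  simpa using hg.inv

lemma exists_lact_eq {n : ℕ} (T : V n →ₗ[ℝ] V n) (hT : LinearMap.det T = 1) :
    ∃ a : SLR n, ∀ x, lact a x = T x := by
  refine ⟨⟨LinearMap.toMatrix' T, by simpa using hT⟩, fun x => ?_⟩
  simp [lact, LinearMap.toMatrix'_mulVec]

/-- An element of `SL(n,ℝ)` contracting a given hyperplane. -/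
lemma exists_contraction {n : ℕ} (ℓ : V n →L[ℝ] ℝ) (hℓ : ℓ ≠ 0) :
    ∃ a : SLR n, ∀ (k : ℕ) x, ℓ x = 0 → lact (a ^ k) x = (1 / 2 : ℝ) ^ k • x := by
  obtain ⟨z, hz⟩ : ∃ z, ℓ z = 1 := by
    obtain ⟨y, hy⟩ := ContinuousLinearMap.exists_ne_zero hℓ
    exact ⟨(ℓ y)⁻¹ • y, by simp [hy]⟩
  obtain ⟨a, ha⟩ := exists_lact_eq
    ((1 / 2 : ℝ) • LinearMap.transvection (ℓ : V n →ₗ[ℝ] ℝ) (((2 : ℝ) ^ n - 1) • z)) (by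
      rw [LinearMap.det_smul, LinearMap.transvection.det]
      simp [hz])
  refine ⟨a, fun k => ?_⟩
  induction k with
  | zero => intro x _; simp [lact_one]
  | succ k ih =>
    intro x hx
    have : lact a x = (1 / 2 : ℝ) • x := by
      rw [ha]; simp [LinearMap.transvection.apply, hx]
    rw [pow_succ, lact_mul, this, lact_smul, ih x hx, smul_smul, pow_succ, mul_comm]

/-- An element of `SL(n,ℝ)` expanding a direction, contracting another one, and fixing a
complement pointwise. -/
lemma exists_hyperbolic {n : ℕ} (p q : V n →L[ℝ] ℝ) (e f : V n) (hpe : p e = 1) (hpf : p f = 0)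
    (hqe : q e = 0) (hqf : q f = 1) :
    ∃ a : SLR n, ∀ (k : ℕ), lact (a ^ k) e = (2 : ℝ) ^ k • e ∧
      lact (a ^ k) f = (1 / 2 : ℝ) ^ k • f ∧
      ∀ x, p x = 0 → q x = 0 → lact (a ^ k) x = x := by
  obtain ⟨a, ha⟩ := exists_lact_eq
    (LinearMap.transvection (p : V n →ₗ[ℝ] ℝ) e ∘ₗ
      LinearMap.transvection (q : V n →ₗ[ℝ] ℝ) ((-1 / 2 : ℝ) • f)) (by
      rw [LinearMap.det_comp, LinearMap.transvection.det, LinearMap.transvection.det]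
      simp [hpe, hqf]; norm_num)
  have he : lact a e = (2 : ℝ) • e := by
    rw [ha]; simp [LinearMap.transvection.apply, hpe, hqe, two_smul]
  have hf : lact a f = (1 / 2 : ℝ) • f := by
    rw [ha]; simp only [LinearMap.transvection.apply, LinearMap.comp_apply,
      ContinuousLinearMap.coe_coe, hqf, map_add, map_smul, hpf]
    simp; module
  have hx : ∀ x, p x = 0 → q x = 0 → lact a x = x := by
    intro x h1 h2
    rw [ha]; simp [LinearMap.transvection.apply, h1, h2]
  refine ⟨a, fun k => ?_⟩
  induction k with
  | zero => simp [lact_one]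
  | succ k ih =>
    obtain ⟨i1, i2, i3⟩ := ih
    refine ⟨?_, ?_, ?_⟩
    · rw [pow_succ, lact_mul, he, lact_smul, i1, smul_smul, pow_succ, mul_comm]
    · rw [pow_succ, lact_mul, hf, lact_smul, i2, smul_smul, pow_succ, mul_comm]
    · intro x h1 h2
      rw [pow_succ, lact_mul, hx x h1 h2, i3 x h1 h2]

lemma Recurrent.contracting {n : ℕ} {Γ : Subgroup (SLR n)} (hR : Recurrent Γ)
    (ℓ : V n →L[ℝ] ℝ) (hℓ : ℓ ≠ 0) :
    ∃ (g : ℕ → SLR n) (γ : ℕ → Γ), Tendsto g atTop (𝓝 1) ∧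
      ∀ r : ℝ, ∀ U ∈ 𝓝 (0 : V n), ∀ᶠ j in atTop, ∀ x, ‖x‖ ≤ r → ℓ (lact (g j) x) = 0 →
        lact (γ j : SLR n) x ∈ U := by
  obtain ⟨a, ha⟩ := exists_contraction ℓ hℓ
  obtain ⟨g, g', κ, γ, hg, hg', hκ, hγ⟩ := hR a
  refine ⟨g, γ, hg, fun r U hU => ?_⟩
  obtain ⟨ε, hε, hεU⟩ := Metric.mem_nhds_iff.1 hU
  have h1 : Tendsto (fun j => ‖act (g' j)⁻¹‖ * ((1 / 2 : ℝ) ^ κ j * (‖act (g j)‖ * |r|))) atTop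
      (𝓝 (‖act (1 : SLR n)‖ * (0 * (‖act (1 : SLR n)‖ * |r|)))) :=
    (tendsto_act (tendsto_inv_one hg')).norm.mul
      (((tendsto_pow_atTop_nhds_zero_of_lt_one (by norm_num) (by norm_num)).comp hκ).mul
        ((tendsto_act hg).norm.mul_const _))
  have h2 := h1.eventually_lt_const (u := ε) (by simpa using hε)
  filter_upwards [h2] with j hj x hx hxl
  apply hεU
  rw [mem_ball_zero_iff, hγ, lact_mul, lact_mul, ha _ _ hxl]
  refine lt_of_le_of_lt ?_ hj
  refine ((act (g' j)⁻¹).le_opNorm _).trans ?_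
  gcongr
  rw [norm_smul, norm_pow]
  gcongr
  · norm_num
  · exact ((act (g j)).le_opNorm _).trans (by gcongr; exact hx.trans (le_abs_self r))

lemma tendsto_comp_act {n : ℕ} {ι : Type*} {l : Filter ι} {g : ι → SLR n}
    (hg : Tendsto g l (𝓝 1)) (ℓ : V n →L[ℝ] ℝ) :
    Tendsto (fun j => ℓ.comp (act (g j))) l (𝓝 ℓ) := by
  have h := ((ContinuousLinearMap.compL ℝ (V n) (V n) ℝ ℓ).continuous.tendsto _).comp
    (tendsto_act hg)
  simpa [Function.comp_def] using h

/-- The linear functionals whose kernel is contained in `S`. -/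
def kernelsIn {n : ℕ} (S : Set (V n)) : Set (V n →L[ℝ] ℝ) := {ℓ | ∀ x, ℓ x = 0 → x ∈ S}

lemma isOpen_boundedKernelsIn {n : ℕ} {S : Set (V n)} (hS : IsOpen S) (r : ℝ) :
    IsOpen {ℓ : V n →L[ℝ] ℝ | ∀ x, ‖x‖ ≤ r → ℓ x = 0 → x ∈ S} := by
  rw [isOpen_iff_mem_nhds]
  intro ℓ hℓ
  have hK : IsCompact (Metric.closedBall (0 : V n) r ∩ Sᶜ) :=
    (isCompact_closedBall 0 r).inter_right hS.isClosed_compl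
  have := hK.eventually_forall_of_forall_eventually (x₀ := ℓ) (P := fun ℓ x => ℓ x ≠ 0) (by
    rintro x ⟨hx, hxS⟩
    have : ContinuousAt (fun z : (V n →L[ℝ] ℝ) × V n => z.1 z.2) (ℓ, x) :=
      (isBoundedBilinearMap_apply (𝕜 := ℝ) (E := V n) (F := ℝ)).continuous.continuousAt
    exact this.eventually_ne fun h => hxS (hℓ x (by simpa using hx) h))
  filter_upwards [this] with ℓ' h' x hx hx0
  by_contra hxS
  exact h' x ⟨by simpa using hx, hxS⟩ hx0

lemma Recurrent.dense_kernelsIn {n : ℕ} (hn : 0 < n) {Γ : Subgroup (SLR n)} (hR : Recurrent Γ)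
    {S : Set (V n)} (hS : IsOpen S) (h0 : (0 : V n) ∈ S)
    (hinv : ∀ γ : Γ, ∀ u ∈ S, lact (γ : SLR n) u ∈ S) : Dense (kernelsIn S) := by
  have : Nonempty (Fin n) := ⟨⟨0, hn⟩⟩
  have hrep : kernelsIn S =
      ⋂ r : ℕ, {ℓ : V n →L[ℝ] ℝ | ∀ x, ‖x‖ ≤ (r : ℝ) → ℓ x = 0 → x ∈ S} := by
    ext ℓ
    simp only [kernelsIn, mem_ofPred_eq, mem_iInter]
    refine ⟨fun h r x _ => h x, fun h x => ?_⟩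
    obtain ⟨r, hr⟩ := exists_nat_ge ‖x‖
    exact h r x hr
  rw [hrep]
  refine dense_iInter_of_isOpen_nat (fun r => isOpen_boundedKernelsIn hS r) fun r => ?_
  have hd : Dense ({0}ᶜ : Set (V n →L[ℝ] ℝ)) := dense_compl_singleton 0
  refine dense_closure.1 (hd.mono fun ℓ hℓ => ?_)
  obtain ⟨g, γ, hg, hc⟩ := hR.contracting ℓ hℓ
  refine mem_closure_of_tendsto (tendsto_comp_act hg ℓ) ?_
  filter_upwards [hc r S (hS.mem_nhds h0)] with j hj x hx hx0
  have := hinv (γ j)⁻¹ _ (hj x hx hx0)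
  rwa [InvMemClass.coe_inv, lact_inv_lact] at this

/-- `h` is near `u` an analytic lift to `S'` of `Φ` through `Φ'`. -/
def IsLift {n : ℕ} {M : Type*} (Φ Φ' : V n → M) (S' : Set (V n)) (h : V n → V n) (u : V n) : Prop :=
  AnalyticAt ℝ h u ∧ ∀ᶠ x in 𝓝 u, h x ∈ S' ∧ Φ' (h x) = Φ x

lemma IsLift.eventually {n : ℕ} {M : Type*} {Φ Φ' : V n → M} {S' : Set (V n)} {h : V n → V n} {u : V n}
    (H : IsLift Φ Φ' S' h u) : ∀ᶠ x in 𝓝 u, IsLift Φ Φ' S' h x := by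
  filter_upwards [H.1.eventually_analyticAt, H.2.eventually_nhds] with x h1 h2
  exact ⟨h1, h2⟩

lemma IsLift.congr {n : ℕ} {M : Type*} {Φ Φ' : V n → M} {S' : Set (V n)} {h k : V n → V n} {u : V n}
    (H : IsLift Φ Φ' S' h u) (hk : h =ᶠ[𝓝 u] k) : IsLift Φ Φ' S' k u := by
  refine ⟨H.1.congr hk, ?_⟩
  filter_upwards [H.2, hk] with x h1 h2
  rwa [← h2]

section Developing

variable {n : ℕ} {M : Type*} [TopologicalSpace M] [ChartedSpace (V n) M]

/-- An equivariant local analytic diffeomorphism `Φ` on an open invariant neighbourhood `S` of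
the origin. -/
structure IsDeveloping (Γ : Subgroup (SLR n)) (ρ : Γ →* Equiv.Perm M) (S : Set (V n))
    (Φ : V n → M) : Prop where
  isOpen : IsOpen S
  zero_mem : (0 : V n) ∈ S
  lact_mem : ∀ γ : Γ, ∀ u ∈ S, lact (γ : SLR n) u ∈ S
  diffeo : LocalAnaDiffeoOn (V n) (V n) Φ S
  equivariant : ∀ γ : Γ, ∀ u ∈ S, Φ (lact (γ : SLR n) u) = ρ γ (Φ u)

lemma GoodExt.isDeveloping {Γ : Subgroup (SLR n)} {ρ : Γ →* Equiv.Perm M} {φ : V n → M}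
    {S : Set (V n)} {Φ : V n → M}
    (h : GoodExt (fun γ : Γ => lact (γ : SLR n)) (fun γ : Γ => ⇑(ρ γ)) φ S Φ) :
    IsDeveloping Γ ρ S Φ :=
  ⟨h.1, h.2.2.1, h.2.2.2.1, h.2.2.2.2.2.1, h.2.2.2.2.2.2⟩

namespace IsDeveloping

variable {Γ : Subgroup (SLR n)} {ρ : Γ →* Equiv.Perm M} {S S' : Set (V n)} {Φ Φ' : V n → M}

lemma eventually_mem (h : IsDeveloping Γ ρ S Φ) {u : V n} (hu : u ∈ S) : ∀ᶠ x in 𝓝 u, x ∈ S :=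
  h.isOpen.mem_nhds hu

lemma cAnalyticAt (h : IsDeveloping Γ ρ S Φ) {u : V n} (hu : u ∈ S) :
    CAnalyticAt (V n) (V n) Φ u := by
  obtain ⟨U, -, huU, -, -, -, hU, -⟩ := h.diffeo u hu
  exact hU u huU

lemma exists_injOn (h : IsDeveloping Γ ρ S Φ) {u : V n} (hu : u ∈ S) :
    ∃ U ∈ 𝓝 u, InjOn Φ U := by
  obtain ⟨U, hU, huU, -, hinj, -⟩ := h.diffeo u hu
  exact ⟨U, hU.mem_nhds huU, hinj⟩

lemma contracting_injective (h : IsDeveloping Γ ρ S Φ) (hR : Recurrent Γ)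
    (ℓ : V n →L[ℝ] ℝ) (hℓ : ℓ ≠ 0) :
    ∃ g : ℕ → SLR n, Tendsto g atTop (𝓝 1) ∧ ∀ r : ℝ, ∀ᶠ j in atTop, ∀ y ∈ S, ∀ y' ∈ S,
      ‖y‖ ≤ r → ‖y'‖ ≤ r → ℓ (lact (g j) y) = 0 → ℓ (lact (g j) y') = 0 → Φ y = Φ y' →
      y = y' := by
  obtain ⟨g, γ, hg, hc⟩ := hR.contracting ℓ hℓ
  obtain ⟨U, hU, hinj⟩ := h.exists_injOn h.zero_mem
  refine ⟨g, hg, fun r => ?_⟩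
  filter_upwards [hc r U hU] with j hj y hy y' hy' hr hr' h0 h0' he
  have : lact (γ j : SLR n) y = lact (γ j : SLR n) y' := by
    refine hinj (hj y hr h0) (hj y' hr' h0') ?_
    rw [h.equivariant _ y hy, h.equivariant _ y' hy', he]
  simpa [lact_inv_lact] using congrArg (lact (γ j : SLR n)⁻¹) this

lemma exists_isLift (D : IsDeveloping Γ ρ S Φ) (D' : IsDeveloping Γ ρ S' Φ') {u v : V n}
    (hu : u ∈ S) (hv : v ∈ S') (he : Φ u = Φ' v) :
    ∃ h : V n → V n, h u = v ∧ IsLift Φ Φ' S' h u := by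
  obtain ⟨U, hU, hvU, hUS, hinj, hUo, -, g, hg, hga⟩ := D'.diffeo v hv
  obtain ⟨hc, ha⟩ := D.cAnalyticAt hu
  have hmem : Φ u ∈ Set.image Φ' U := ⟨v, hvU, he.symm⟩
  obtain ⟨hgc, hga⟩ := hga _ hmem
  refine ⟨g ∘ Φ, ?_, ?_, ?_⟩
  · simp [he, hg hvU]
  · simp only [chartAt_self_eq, OpenPartialHomeomorph.refl_symm,
      OpenPartialHomeomorph.refl_apply] at ha hga
    have hcomp := AnalyticAt.fun_comp (f := (chartAt (V n) (Φ u)) ∘ Φ) (x := u) (by exact hga)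
      (by exact ha)
    refine hcomp.congr ?_
    filter_upwards [hc.eventually ((chartAt (V n) (Φ u)).open_source.mem_nhds
      (mem_chart_source (V n) (Φ u)))] with x hx
    simp only [Function.comp_apply]
    have : (chartAt (V n) (Φ u)).symm ((chartAt (V n) (Φ u)) (Φ x)) = Φ x :=
      (chartAt (V n) (Φ u)).left_inv hx
    simp [this]
  · filter_upwards [hc.eventually (hUo.mem_nhds hmem)] with x hx
    obtain ⟨y, hy, hyx⟩ := hx
    have : (g ∘ Φ) x = y := by simp [← hyx, hg hy]
    rw [this]
    exact ⟨hUS hy, hyx⟩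

lemma exists_lift_inverse (D : IsDeveloping Γ ρ S Φ) (D' : IsDeveloping Γ ρ S' Φ') {u : V n}
    {h : V n → V n} (hu : u ∈ S) (H : IsLift Φ Φ' S' h u) :
    ∃ k : V n → V n, k (h u) = u ∧ IsLift Φ' Φ S k (h u) ∧ (∀ᶠ x in 𝓝 u, k (h x) = x) ∧
      ∀ᶠ y in 𝓝 (h u), h (k y) = y := by
  have aux : ∀ {S S' : Set (V n)} {Φ Φ' : V n → M} {h k : V n → V n} {u : V n}
      (_ : IsDeveloping Γ ρ S Φ), u ∈ S → IsLift Φ Φ' S' h u → IsLift Φ' Φ S k (h u) →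
      k (h u) = u → ∀ᶠ x in 𝓝 u, k (h x) = x := by
    intro S S' Φ Φ' h k u D hu H K hku
    obtain ⟨U, hU, hinj⟩ := D.exists_injOn hu
    have hkc : Tendsto (fun x => k (h x)) (𝓝 u) (𝓝 u) := by
      have := K.1.continuousAt.tendsto.comp H.1.continuousAt.tendsto
      rwa [hku] at this
    filter_upwards [hU, hkc.eventually hU, H.2, H.1.continuousAt.tendsto.eventually K.2]
      with x h1 h2 h3 h4
    exact hinj h2 h1 (by rw [h4.2, h3.2])
  obtain ⟨hm, he⟩ := H.2.self_of_nhds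
  obtain ⟨k, hk, K⟩ := D'.exists_isLift D hm hu he
  refine ⟨k, hk, K, aux D hu H K hk, ?_⟩
  exact aux (h := k) (k := h) D' hm K (by rwa [hk]) (by rw [hk])

end IsDeveloping

end Developing

lemma exists_functional_pair {E : Type*} [AddCommGroup E] [Module ℝ E] {a b : E → ℝ}
    (ha : ∀ (r s : ℝ) x y, a (r • x + s • y) = r * a x + s * a y)
    (hb : ∀ (r s : ℝ) x y, b (r • x + s • y) = r * b x + s * b y) {z z' : E}
    (h : a z * b z' ≠ a z' * b z) (s t : ℝ) : ∃ x, a x = s ∧ b x = t := by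
  have hd : a z * b z' - a z' * b z ≠ 0 := sub_ne_zero.2 h
  refine ⟨((s * b z' - t * a z') / (a z * b z' - a z' * b z)) • z +
    ((a z * t - b z * s) / (a z * b z' - a z' * b z)) • z', ?_, ?_⟩
  · rw [ha, div_mul_eq_mul_div, div_mul_eq_mul_div, ← add_div, div_eq_iff hd]; ring
  · rw [hb, div_mul_eq_mul_div, div_mul_eq_mul_div, ← add_div, div_eq_iff hd]; ring

namespace IsDeveloping

variable {n : ℕ} {M : Type*} [TopologicalSpace M] [ChartedSpace (V n) M]
variable {Γ : Subgroup (SLR n)} {ρ : Γ →* Equiv.Perm M} {S : Set (V n)} {Φ : V n → M}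

/-- Two distinct local maps into `S` with the same image under `Φ` are not transverse to any
hyperplane containing both values. -/
lemma dependent (D : IsDeveloping Γ ρ S Φ) (hR : Recurrent Γ) {h₁ h₂ : V n → V n}
    {X₁ X₂ : V n →L[ℝ] V n} {u : V n} (H₁ : HasStrictFDerivAt h₁ X₁ u)
    (H₂ : HasStrictFDerivAt h₂ X₂ u)
    (hm : ∀ᶠ x in 𝓝 u, h₁ x ∈ S ∧ h₂ x ∈ S ∧ Φ (h₁ x) = Φ (h₂ x)) (hne : h₁ u ≠ h₂ u)
    (ℓ : V n →L[ℝ] ℝ) (h1 : ℓ (h₁ u) = 0) (h2 : ℓ (h₂ u) = 0) (z z' : V n) :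
    ℓ (X₁ z) * ℓ (X₂ z') = ℓ (X₁ z') * ℓ (X₂ z) := by
  by_contra hdet
  have hℓ : ℓ ≠ 0 := by rintro rfl; simp at hdet
  obtain ⟨g, hg, hc⟩ := D.contracting_injective hR ℓ hℓ
  let F : (V n →L[ℝ] ℝ) × V n → (V n →L[ℝ] ℝ) × (ℝ × ℝ) :=
    fun w => (w.1, (w.1 (h₁ w.2), w.1 (h₂ w.2)))
  have e1 : HasStrictFDerivAt (fun w : (V n →L[ℝ] ℝ) × V n => w.1)
    (ContinuousLinearMap.fst ℝ (V n →L[ℝ] ℝ) (V n)) (ℓ, u) := hasStrictFDerivAt_fst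
  have e2 : HasStrictFDerivAt (fun w : (V n →L[ℝ] ℝ) × V n => w.2)
    (ContinuousLinearMap.snd ℝ (V n →L[ℝ] ℝ) (V n)) (ℓ, u) := hasStrictFDerivAt_snd
  have k1 := HasStrictFDerivAt.comp (g := h₁) (ℓ, u) H₁ e2
  have k2 := HasStrictFDerivAt.comp (g := h₂) (ℓ, u) H₂ e2
  have hF := e1.prodMk ((e1.clm_apply k1).prodMk (e1.clm_apply k2))
  have hmap := hF.map_nhds_eq_of_surj (by
    rw [LinearMap.range_eq_top]
    rintro ⟨m, s, t⟩
    obtain ⟨x, hx, hx'⟩ := exists_functional_pair (a := fun x => ℓ (X₁ x))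
      (b := fun x => ℓ (X₂ x)) (by intros; simp) (by intros; simp) hdet (s - m (h₁ u))
      (t - m (h₂ u))
    refine ⟨(m, x), ?_⟩
    simp only [ContinuousLinearMap.coe_coe, ContinuousLinearMap.prod_apply, Prod.mk.injEq]
    refine ⟨rfl, ?_, ?_⟩ <;> simp_all)
  have hN : ∀ᶠ w in 𝓝 (ℓ, u), h₁ w.2 ∈ S ∧ h₂ w.2 ∈ S ∧ Φ (h₁ w.2) = Φ (h₂ w.2) ∧
      h₁ w.2 ≠ h₂ w.2 ∧ ‖h₁ w.2‖ ≤ ‖h₁ u‖ + ‖h₂ u‖ + 1 ∧ ‖h₂ w.2‖ ≤ ‖h₁ u‖ + ‖h₂ u‖ + 1 := by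
    have hs : Tendsto (fun w : (V n →L[ℝ] ℝ) × V n => w.2) (𝓝 (ℓ, u)) (𝓝 u) :=
      continuous_snd.tendsto (ℓ, u)
    refine hs.eventually (p := fun x => h₁ x ∈ S ∧ h₂ x ∈ S ∧ Φ (h₁ x) = Φ (h₂ x) ∧
      h₁ x ≠ h₂ x ∧ ‖h₁ x‖ ≤ ‖h₁ u‖ + ‖h₂ u‖ + 1 ∧ ‖h₂ x‖ ≤ ‖h₁ u‖ + ‖h₂ u‖ + 1) ?_
    have c1 := H₁.continuousAt
    have c2 := H₂.continuousAt
    have n1 := c1.norm.eventually_le_const (u := ‖h₁ u‖ + ‖h₂ u‖ + 1)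
      (by linarith [norm_nonneg (h₂ u)])
    have n2 := c2.norm.eventually_le_const (u := ‖h₁ u‖ + ‖h₂ u‖ + 1)
      (by linarith [norm_nonneg (h₁ u)])
    filter_upwards [hm, (ContinuousAt.ne_iff_eventually_ne c1 c2).1 hne, n1, n2] with x a1 a2 a3 a4
    exact ⟨a1.1, a1.2.1, a1.2.2, a2, a3, a4⟩
  have hN' := image_mem_map (m := F) hN
  change F '' _ ∈ Filter.map (fun w => F w) _ at hN'
  rw [hmap] at hN'
  have ht : Tendsto (fun j => (ℓ.comp (act (g j)), ((0 : ℝ), (0 : ℝ)))) atTop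
      (𝓝 (ℓ, (ℓ (h₁ u), ℓ (h₂ u)))) := by
    rw [h1, h2]
    exact (tendsto_comp_act hg ℓ).prodMk_nhds tendsto_const_nhds
  obtain ⟨j, hj, hj'⟩ := ((ht.eventually hN').and (hc (‖h₁ u‖ + ‖h₂ u‖ + 1))).exists
  obtain ⟨⟨m, x⟩, ⟨b1, b2, b3, b4, b5, b6⟩, hw⟩ := hj
  simp only [F, Prod.mk.injEq] at hw
  obtain ⟨rfl, hw1, hw2⟩ := hw
  exact b4 (hj' _ b1 _ b2 b5 b6 hw1 hw2 b3)

lemma eq_of_parallel (D : IsDeveloping Γ ρ S Φ) (hR : Recurrent Γ) {h₁ h₂ : V n → V n}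
    {u : V n} (c1 : ContinuousAt h₁ u) (c2 : ContinuousAt h₂ u)
    (hm : ∀ᶠ x in 𝓝 u, h₁ x ∈ S ∧ h₂ x ∈ S ∧ Φ (h₁ x) = Φ (h₂ x))
    (hp : ∀ᶠ x in 𝓝 u, (∃ c : ℝ, h₁ x = c • x) ∧ ∃ c : ℝ, h₂ x = c • x)
    (ℓ : V n →L[ℝ] ℝ) (hℓ : ℓ ≠ 0) (hu : ℓ u = 0) : h₁ u = h₂ u := by
  by_contra hne
  obtain ⟨g, hg, hc⟩ := D.contracting_injective hR ℓ hℓ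
  have n1 := c1.norm.eventually_le_const (u := ‖h₁ u‖ + ‖h₂ u‖ + 1)
    (by linarith [norm_nonneg (h₂ u)])
  have n2 := c2.norm.eventually_le_const (u := ‖h₁ u‖ + ‖h₂ u‖ + 1)
    (by linarith [norm_nonneg (h₁ u)])
  have ht : Tendsto (fun j => lact (g j)⁻¹ u) atTop (𝓝 u) :=
    tendsto_lact_one (tendsto_inv_one hg) tendsto_const_nhds
  obtain ⟨j, ⟨a1, a2, a3, a4, a5⟩, hj⟩ := ((ht.eventually (hm.and (hp.and
    (((ContinuousAt.ne_iff_eventually_ne c1 c2).1 hne).and (n1.and n2))))).and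
    (hc (‖h₁ u‖ + ‖h₂ u‖ + 1))).exists
  obtain ⟨⟨s, hs⟩, t, ht⟩ := a2
  refine a3 (hj _ a1.1 _ a1.2.1 a4 a5 ?_ ?_ a1.2.2)
  · rw [hs, lact_smul, lact_lact_inv]; simp [hu]
  · rw [ht, lact_smul, lact_lact_inv]; simp [hu]

end IsDeveloping

lemma exists_functional_of_linearIndependent {n : ℕ} {ι : Type*} {w : ι → V n}
    (hw : LinearIndependent ℝ w) (c : ι → ℝ) : ∃ f : V n →L[ℝ] ℝ, ∀ i, f (w i) = c i := by
  obtain ⟨f, hf⟩ := LinearMap.exists_extend ((Module.Basis.span hw).constr ℝ c)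
  refine ⟨LinearMap.toContinuousLinearMap f, fun i => ?_⟩
  have h := LinearMap.congr_fun hf (Module.Basis.span hw i)
  rw [Module.Basis.constr_basis] at h
  simpa [Module.Basis.span_apply] using h

lemma exists_functional_of_notMem {n : ℕ} (W : Submodule ℝ (V n)) {x : V n} (hx : x ∉ W) :
    ∃ f : V n →L[ℝ] ℝ, f x ≠ 0 ∧ ∀ y ∈ W, f y = 0 := by
  obtain ⟨f, hf, h⟩ := Submodule.exists_le_ker_of_notMem hx
  exact ⟨LinearMap.toContinuousLinearMap f, hf, fun y hy => by simpa using h hy⟩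

/-- A functional vanishing on two independent vectors can be perturbed to vanish on nearby
vectors. -/
lemma exists_tendsto_functional {n : ℕ} {ℓ : V n →L[ℝ] ℝ} {v m : V n} {vj mj : ℕ → V n}
    (hvm : LinearIndependent ℝ ![v, m]) (hv : ℓ v = 0) (hm : ℓ m = 0)
    (tv : Tendsto vj atTop (𝓝 v)) (tm : Tendsto mj atTop (𝓝 m)) :
    ∃ L : ℕ → V n →L[ℝ] ℝ, Tendsto L atTop (𝓝 ℓ) ∧
      ∀ᶠ j in atTop, L j (vj j) = 0 ∧ L j (mj j) = 0 := by
  obtain ⟨p, hp⟩ := exists_functional_of_linearIndependent hvm ![1, 0]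
  obtain ⟨q, hq⟩ := exists_functional_of_linearIndependent hvm ![0, 1]
  have p1 : p v = 1 := by simpa using hp 0
  have p2 : p m = 0 := by simpa using hp 1
  have q1 : q v = 0 := by simpa using hq 0
  have q2 : q m = 1 := by simpa using hq 1
  have T : ∀ (f : V n →L[ℝ] ℝ) {xj : ℕ → V n} {x : V n}, Tendsto xj atTop (𝓝 x) →
      Tendsto (fun j => f (xj j)) atTop (𝓝 (f x)) := fun f xj x h => (f.continuous.tendsto x).comp h
  have td : Tendsto (fun j => p (vj j) * q (mj j) - q (vj j) * p (mj j)) atTop (𝓝 1) := by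
    simpa [p1, p2, q1, q2] using ((T p tv).mul (T q tm)).sub ((T q tv).mul (T p tm))
  have ta : Tendsto (fun j => (ℓ (vj j) * q (mj j) - q (vj j) * ℓ (mj j)) /
      (p (vj j) * q (mj j) - q (vj j) * p (mj j))) atTop (𝓝 0) := by
    simpa [hv, hm, Pi.div_def] using (((T ℓ tv).mul (T q tm)).sub ((T q tv).mul (T ℓ tm))).div td one_ne_zero
  have tb : Tendsto (fun j => (p (vj j) * ℓ (mj j) - ℓ (vj j) * p (mj j)) /
      (p (vj j) * q (mj j) - q (vj j) * p (mj j))) atTop (𝓝 0) := by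
    simpa [hv, hm, Pi.div_def] using (((T p tv).mul (T ℓ tm)).sub ((T ℓ tv).mul (T p tm))).div td one_ne_zero
  refine ⟨fun j => ℓ - ((ℓ (vj j) * q (mj j) - q (vj j) * ℓ (mj j)) /
      (p (vj j) * q (mj j) - q (vj j) * p (mj j))) • p -
      ((p (vj j) * ℓ (mj j) - ℓ (vj j) * p (mj j)) /
      (p (vj j) * q (mj j) - q (vj j) * p (mj j))) • q, ?_, ?_⟩
  · simpa using (tendsto_const_nhds.sub (ta.smul_const p)).sub (tb.smul_const q)
  · filter_upwards [td.eventually_ne one_ne_zero] with j hj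
    simp only [_root_.sub_apply, _root_.smul_apply, smul_eq_mul]
    constructor <;>
    · rw [div_mul_eq_mul_div, div_mul_eq_mul_div, sub_sub, ← add_div, sub_eq_zero, eq_div_iff hj]
      ring

lemma Recurrent.hyperbolic {n : ℕ} {Γ : Subgroup (SLR n)} (hR : Recurrent Γ)
    (p q : V n →L[ℝ] ℝ) (e f : V n) (hpe : p e = 1) (hpf : p f = 0)
    (hqe : q e = 0) (hqf : q f = 1) :
    ∃ (g g' : ℕ → SLR n) (κ : ℕ → ℕ) (γ : ℕ → Γ),
    Tendsto g atTop (𝓝 1) ∧ Tendsto g' atTop (𝓝 1) ∧ Tendsto κ atTop atTop ∧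
    ∀ j x, lact (γ j : SLR n) x = lact (g' j)⁻¹
      (lact (g j) x - p (lact (g j) x) • e - q (lact (g j) x) • f +
        (2 : ℝ) ^ κ j • p (lact (g j) x) • e + (1 / 2 : ℝ) ^ κ j • q (lact (g j) x) • f) := by
  obtain ⟨a, ha⟩ := exists_hyperbolic p q e f hpe hpf hqe hqf
  obtain ⟨g, g', κ, γ, hg, hg', hκ, hγ⟩ := hR a
  refine ⟨g, g', κ, γ, hg, hg', hκ, fun j x => ?_⟩
  rw [hγ, lact_mul, lact_mul]
  congr 1
  generalize lact (g j) x = y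
  obtain ⟨h1, h2, h3⟩ := ha (κ j)
  have hy : y = (y - p y • e - q y • f) + p y • e + q y • f := by module
  conv_lhs => rw [hy]
  rw [lact_add, lact_add, lact_smul, lact_smul, h1, h2, h3 _ (by simp [hpe, hpf])
    (by simp [hqe, hqf])]
  module

lemma IsLift.conj {n : ℕ} {M : Type*} [TopologicalSpace M] [ChartedSpace (V n) M]
    {Γ : Subgroup (SLR n)} {ρ : Γ →* Equiv.Perm M} {S S' : Set (V n)} {Φ Φ' : V n → M}
    (D : IsDeveloping Γ ρ S Φ) (D' : IsDeveloping Γ ρ S' Φ') {h : V n → V n} {w : V n}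
    (hw : w ∈ S) (H : IsLift Φ Φ' S' h w) (γ : Γ) :
    IsLift Φ Φ' S' (fun x => lact (γ : SLR n) (h (lact (γ : SLR n)⁻¹ x)))
      (lact (γ : SLR n) w) := by
  have hc : Tendsto (fun x => lact (γ : SLR n)⁻¹ x) (𝓝 (lact (γ : SLR n) w)) (𝓝 w) := by
    have := (act (γ : SLR n)⁻¹).continuous.tendsto (lact (γ : SLR n) w)
    rwa [act_apply, lact_inv_lact] at this
  constructor
  · refine AnalyticAt.fun_comp (g := fun x => lact (γ : SLR n) x)
      ((act (γ : SLR n)).analyticAt _) (AnalyticAt.fun_comp (g := h) ?_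
        ((act (γ : SLR n)⁻¹).analyticAt _))
    simpa [lact_inv_lact] using H.1
  · filter_upwards [hc.eventually H.2, hc.eventually (D.eventually_mem hw)] with x hx hxS
    refine ⟨D'.lact_mem _ _ hx.1, ?_⟩
    rw [D'.equivariant _ _ hx.1, hx.2, ← D.equivariant _ _ hxS, lact_lact_inv]

lemma tendsto_apply {n : ℕ} {ι : Type*} {l : Filter ι} {F : Type*} [NormedAddCommGroup F]
    [NormedSpace ℝ F] {L : ι → V n →L[ℝ] F} {L₀ : V n →L[ℝ] F} {x : ι → V n} {x₀ : V n}
    (hL : Tendsto L l (𝓝 L₀)) (hx : Tendsto x l (𝓝 x₀)) :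
    Tendsto (fun i => L i (x i)) l (𝓝 (L₀ x₀)) :=
  ((isBoundedBilinearMap_apply (𝕜 := ℝ) (E := V n) (F := F)).continuous.tendsto (L₀, x₀)).comp
    (hL.prodMk_nhds hx)

section

variable {n : ℕ} {M : Type*} [TopologicalSpace M] [ChartedSpace (V n) M]
    {Γ : Subgroup (SLR n)} {ρ : Γ →* Equiv.Perm M} {S S' : Set (V n)} {Φ Φ' : V n → M}

lemma IsLift.fderiv_mul_eq_zero (hR : Recurrent Γ) (D : IsDeveloping Γ ρ S Φ)
    (D' : IsDeveloping Γ ρ S' Φ') {h : V n → V n} {u : V n} (hu : u ∈ S)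
    (H : IsLift Φ Φ' S' h u) {p q ℓ : V n →L[ℝ] ℝ} {e f : V n} {t : ℝ} (ht : t ≠ 0)
    (hv : h u = e + t • f) (hpe : p e = 1) (hpf : p f = 0) (hqe : q e = 0) (hqf : q f = 1)
    (hpu : p u = 0) (hqu : q u = 0) (hℓe : ℓ e = 0) (hℓf : ℓ f = 0) :
    ℓ (fderiv ℝ h u e) * ℓ (fderiv ℝ h u f) = 0 := by
  obtain ⟨g, g', κ, γ, hg, hg', hκ, hγ⟩ := hR.hyperbolic p q e f hpe hpf hqe hqf
  have hgi := tendsto_inv_one hg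
  have hgi' := tendsto_inv_one hg'
  have tpow : Tendsto (fun j => (1 / 2 : ℝ) ^ κ j) atTop (𝓝 0) :=
    (tendsto_pow_atTop_nhds_zero_of_lt_one (by norm_num) (by norm_num)).comp hκ
  have hpow : ∀ j, (1 / 2 : ℝ) ^ κ j * 2 ^ κ j = 1 := fun j => by
    rw [← mul_pow]; norm_num
  have T : ∀ (f : V n →L[ℝ] ℝ) {xj : ℕ → V n} {x : V n}, Tendsto xj atTop (𝓝 x) →
      Tendsto (fun j => f (xj j)) atTop (𝓝 (f x)) := fun f xj x h => (f.continuous.tendsto x).comp h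
  set w : ℕ → V n := fun j => lact (g j)⁻¹ u with hw
  set u' : ℕ → V n := fun j => lact (g' j)⁻¹ u with hu'
  have tw : Tendsto w atTop (𝓝 u) := tendsto_lact_one hgi tendsto_const_nhds
  have tu' : Tendsto u' atTop (𝓝 u) := tendsto_lact_one hgi' tendsto_const_nhds
  have hγw : ∀ j, lact (γ j : SLR n) (w j) = u' j := fun j => by
    rw [hγ]; simp [hw, hu', lact_lact_inv, hpu, hqu]
  have hcont := H.1.continuousAt.tendsto
  have tv : Tendsto (fun j => h (u' j)) atTop (𝓝 (h u)) := hcont.comp tu'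
  have ty : Tendsto (fun j => lact (g j) (h (w j))) atTop (𝓝 (h u)) :=
    tendsto_lact_one hg (hcont.comp tw)
  have hpv : p (h u) = 1 := by simp [hv, hpe, hpf]
  have tm : Tendsto (fun j => (1 / 2 : ℝ) ^ κ j • lact (γ j : SLR n) (h (w j))) atTop (𝓝 e) := by
    have key : ∀ j, (1 / 2 : ℝ) ^ κ j • lact (γ j : SLR n) (h (w j)) = lact (g' j)⁻¹
        ((1 / 2 : ℝ) ^ κ j • (lact (g j) (h (w j)) - p (lact (g j) (h (w j))) • e -
          q (lact (g j) (h (w j))) • f) + p (lact (g j) (h (w j))) • e +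
          ((1 / 2 : ℝ) ^ κ j * (1 / 2 : ℝ) ^ κ j) • q (lact (g j) (h (w j))) • f) := by
      intro j
      rw [hγ, ← lact_smul, smul_add, smul_add, smul_smul, hpow, one_smul, smul_smul]
    simp_rw [key]
    refine tendsto_lact_one hgi' ?_
    have := ((tpow.smul ((ty.sub ((T p ty).smul_const e)).sub ((T q ty).smul_const f))).add
      ((T p ty).smul_const e)).add ((tpow.mul tpow).smul ((T q ty).smul_const f))
    simpa [hpv] using this
  have hind : LinearIndependent ℝ ![h u, e] := by
    rw [LinearIndependent.pair_iff]
    intro a b hab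
    have h1 := congrArg q hab
    have h2 := congrArg p hab
    simp [hv, hpe, hpf, hqe, hqf] at h1 h2
    have : a = 0 := by rcases h1 with h1 | h1 <;> [exact h1; exact absurd h1 ht]
    subst this
    exact ⟨rfl, by simpa using h2⟩
  obtain ⟨L, tL, hL⟩ := exists_tendsto_functional (ℓ := ℓ) hind (by simp [hv, hℓe, hℓf]) hℓe tv tm
  set η : ℕ → V n →L[ℝ] ℝ := fun j => (L j).comp (act (g' j)⁻¹) with hη
  have tη : Tendsto η atTop (𝓝 ℓ) := by
    have := ((isBoundedBilinearMap_comp (𝕜 := ℝ) (E := V n) (F := V n) (G := ℝ)).continuous.tendsto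
      (ℓ, act 1)).comp (tL.prodMk_nhds (tendsto_act hgi'))
    simpa [Function.comp_def] using this
  have hLγ : ∀ j x, L j (lact (γ j : SLR n) x) =
      η j (lact (g j) x - p (lact (g j) x) • e - q (lact (g j) x) • f) +
        (2 : ℝ) ^ κ j * η j e * p (lact (g j) x) +
        (1 / 2 : ℝ) ^ κ j * (q (lact (g j) x) * η j f) := by
    intro j x
    rw [hγ]
    change η j _ = _
    simp only [map_add, map_smul, smul_eq_mul]
    ring
  have tsub : ∀ {xj : ℕ → V n} {x : V n}, Tendsto xj atTop (𝓝 x) → Tendsto (fun j =>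
      η j (lact (g j) (xj j) - p (lact (g j) (xj j)) • e - q (lact (g j) (xj j)) • f) +
      (1 / 2 : ℝ) ^ κ j * (q (lact (g j) (xj j)) * η j f)) atTop (𝓝 (ℓ x)) := by
    intro xj x hx
    have hx' := tendsto_lact_one hg hx
    have := (tendsto_apply tη ((hx'.sub ((T p hx').smul_const e)).sub
      ((T q hx').smul_const f))).add
      (tpow.mul ((T q hx').mul (tendsto_apply tη (tendsto_const_nhds (x := f)))))
    simpa [hℓe, hℓf] using this
  have tηe : Tendsto (fun j => (2 : ℝ) ^ κ j * η j e) atTop (𝓝 0) := by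
    have h1 := tsub (xj := fun j => h (w j)) (x := h u) (hcont.comp tw)
    have h2 := T p ty
    rw [hpv] at h2
    have h3 := h1.neg.div h2 one_ne_zero
    have hℓv : ℓ (h u) = 0 := by simp [hv, hℓe, hℓf]
    rw [hℓv, neg_zero, zero_div] at h3
    refine h3.congr' ?_
    filter_upwards [hL, h2.eventually_ne one_ne_zero] with j hj hj'
    have h4 : L j (lact (γ j : SLR n) (h (w j))) = 0 := by
      have := hj.2
      rw [map_smul, smul_eq_mul] at this
      exact (mul_eq_zero.1 this).resolve_left (by positivity)
    rw [hLγ] at h4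
    simp only [Pi.div_apply]
    rw [div_eq_iff hj']
    linarith
  have tLγ : ∀ {xj : ℕ → V n} {x : V n}, Tendsto xj atTop (𝓝 x) →
      Tendsto (fun j => L j (lact (γ j : SLR n) (xj j))) atTop (𝓝 (ℓ x)) := by
    intro xj x hx
    have := (tsub hx).add (tηe.mul (T p (tendsto_lact_one hg hx)))
    simp only [zero_mul, add_zero] at this
    refine this.congr fun j => ?_
    rw [hLγ]; ring
  have tX : Tendsto (fderiv ℝ h) (𝓝 u) (𝓝 (fderiv ℝ h u)) := H.1.fderiv.continuousAt.tendsto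
  have tA : ∀ x, Tendsto (fun j => L j (fderiv ℝ h (u' j) (lact (g' j)⁻¹ x))) atTop
      (𝓝 (ℓ (fderiv ℝ h u x))) := fun x =>
    tendsto_apply tL (tendsto_apply (tX.comp tu') (tendsto_lact_one hgi' tendsto_const_nhds))
  have tC : ∀ x, Tendsto (fun j => L j (lact (γ j : SLR n) (fderiv ℝ h (w j) (lact (g j)⁻¹ x))))
      atTop (𝓝 (ℓ (fderiv ℝ h u x))) := fun x =>
    tLγ (tendsto_apply (tX.comp tw) (tendsto_lact_one hgi tendsto_const_nhds))
  have hne : ∀ᶠ j in atTop, h (u' j) ≠ lact (γ j : SLR n) (h (w j)) := by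
    have h1 : Tendsto (fun j => (1 / 2 : ℝ) ^ κ j • lact (γ j : SLR n) (h (w j)) -
        (1 / 2 : ℝ) ^ κ j • h (u' j)) atTop (𝓝 e) := by
      simpa using tm.sub (tpow.smul tv)
    have he0 : e ≠ 0 := by rintro rfl; simp at hpe
    filter_upwards [h1.eventually_ne he0] with j hj heq
    rw [← heq] at hj
    simp at hj
  have hdep : ∀ᶠ j in atTop,
      L j (fderiv ℝ h (u' j) (lact (g' j)⁻¹ e)) *
        L j (lact (γ j : SLR n) (fderiv ℝ h (w j) (lact (g j)⁻¹ f))) =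
      ((1 / 2 : ℝ) ^ κ j * (1 / 2 : ℝ) ^ κ j) * (L j (fderiv ℝ h (u' j) (lact (g' j)⁻¹ f)) *
        L j (lact (γ j : SLR n) (fderiv ℝ h (w j) (lact (g j)⁻¹ e)))) := by
    filter_upwards [hne, hL, tw.eventually H.eventually, tu'.eventually H.eventually,
      tw.eventually (D.eventually_mem hu)] with j hj1 hj2 hj3 hj4 hj5
    have H₂ := hj3.conj D D' hj5 (γ j)
    rw [hγw] at H₂
    have hwu : lact (γ j : SLR n)⁻¹ (u' j) = w j := by rw [← hγw, lact_inv_lact]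
    have d2 : HasStrictFDerivAt (fun x => lact (γ j : SLR n) (h (lact (γ j : SLR n)⁻¹ x)))
        ((act (γ j : SLR n)).comp ((fderiv ℝ h (w j)).comp (act (γ j : SLR n)⁻¹))) (u' j) := by
      refine HasStrictFDerivAt.comp (g := act (γ j : SLR n)) (u' j)
        (act (γ j : SLR n)).hasStrictFDerivAt
        (HasStrictFDerivAt.comp (g := h) (f := act (γ j : SLR n)⁻¹) (u' j) ?_
          (act (γ j : SLR n)⁻¹).hasStrictFDerivAt)
      rw [act_apply, hwu]
      exact hj3.1.hasStrictFDerivAt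
    have h0 : L j (lact (γ j : SLR n) (h (w j))) = 0 := by
      have := hj2.2
      rw [map_smul, smul_eq_mul] at this
      exact (mul_eq_zero.1 this).resolve_left (by positivity)
    have key := D'.dependent hR hj4.1.hasStrictFDerivAt d2 (by
      filter_upwards [hj4.2, H₂.2] with x hx1 hx2
      exact ⟨hx1.1, hx2.1, hx1.2.trans hx2.2.symm⟩) (by rwa [hwu]) (L j) hj2.1 (by rwa [hwu])
      (lact (γ j : SLR n) (lact (g j)⁻¹ e)) (lact (γ j : SLR n) (lact (g j)⁻¹ f))
    have ke : lact (γ j : SLR n) (lact (g j)⁻¹ e) = (2 : ℝ) ^ κ j • lact (g' j)⁻¹ e := by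
      rw [hγ, lact_lact_inv, hpe, hqe, ← lact_smul]; congr 1; simp
    have kf : lact (γ j : SLR n) (lact (g j)⁻¹ f) = (1 / 2 : ℝ) ^ κ j • lact (g' j)⁻¹ f := by
      rw [hγ, lact_lact_inv, hpf, hqf, ← lact_smul]; congr 1; simp
    simp only [ContinuousLinearMap.comp_apply, act_apply, lact_inv_lact] at key
    rw [ke, kf] at key
    simp only [map_smul, smul_eq_mul] at key
    calc _ = (1 / 2 : ℝ) ^ κ j * (2 ^ κ j * (L j) ((fderiv ℝ h (u' j)) (lact (g' j)⁻¹ e)) *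
          (L j) (lact (γ j : SLR n) ((fderiv ℝ h (w j)) (lact (g j)⁻¹ f)))) := by
            rw [← mul_assoc, ← mul_assoc, hpow, one_mul]
      _ = _ := by rw [key]; ring
  have l1 := (tA e).mul (tC f)
  have l2 := (tpow.mul tpow).mul ((tA f).mul (tC e))
  rw [zero_mul, zero_mul] at l2
  exact tendsto_nhds_unique (l1.congr' hdep) l2

end

lemma isOpen_functional_ne {n : ℕ} (f : V n →L[ℝ] ℝ) : IsOpen {x | f x ≠ 0} :=
  isOpen_ne_fun f.continuous continuous_const

lemma dense_functional_ne {n : ℕ} {f : V n →L[ℝ] ℝ} (hf : f ≠ 0) : Dense {x | f x ≠ 0} := by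
  obtain ⟨z, hz⟩ := ContinuousLinearMap.exists_ne_zero hf
  intro x
  by_cases hx : f x = 0
  · have ht : Tendsto (fun k : ℕ => x + (1 / ((k : ℝ) + 1)) • z) atTop (𝓝 (x + (0 : ℝ) • z)) :=
      tendsto_const_nhds.add (tendsto_one_div_add_atTop_nhds_zero_nat.smul_const z)
    rw [zero_smul, add_zero] at ht
    refine mem_closure_of_tendsto ht (Eventually.of_forall fun k => ?_)
    have : (k : ℝ) + 1 ≠ 0 := by positivity
    simp [hx, hz, this]
  · exact subset_closure hx

lemma exists_functional_vanishing {n : ℕ} (W : Submodule ℝ (V n)) (hW : W ≠ ⊤) :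
    ∃ f : V n →L[ℝ] ℝ, f ≠ 0 ∧ ∀ y ∈ W, f y = 0 := by
  obtain ⟨x, -, hx⟩ := SetLike.exists_of_lt (lt_top_iff_ne_top.2 hW)
  obtain ⟨f, hf, h⟩ := exists_functional_of_notMem W hx
  exact ⟨f, by rintro rfl; simp at hf, h⟩

lemma span_pair_ne_top_of_finrank {E : Type*} [AddCommGroup E] [Module ℝ E]
    (hE : 3 ≤ Module.finrank ℝ E) (u v : E) : Submodule.span ℝ ({u, v} : Set E) ≠ ⊤ := by
  classical
  intro h
  have h1 := finrank_span_finset_le_card (R := ℝ) ({u, v} : Finset E)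
  have h2 : ({u, v} : Finset E).card ≤ 2 := Finset.card_le_two
  have hc : (({u, v} : Finset E) : Set E) = {u, v} := by simp
  unfold Set.finrank at h1
  rw [hc, h, finrank_top] at h1
  omega

lemma span_pair_ne_top {n : ℕ} (hn : 3 ≤ n) (u v : V n) :
    Submodule.span ℝ ({u, v} : Set (V n)) ≠ ⊤ :=
  span_pair_ne_top_of_finrank (by rwa [Module.finrank_fin_fun]) u v

section

variable {n : ℕ} {M : Type*} [TopologicalSpace M] [ChartedSpace (V n) M]
    {Γ : Subgroup (SLR n)} {ρ : Γ →* Equiv.Perm M} {S S' : Set (V n)} {Φ Φ' : V n → M}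

lemma IsLift.fderiv_mem_span (hR : Recurrent Γ) (D : IsDeveloping Γ ρ S Φ)
    (D' : IsDeveloping Γ ρ S' Φ') {h : V n → V n} {u : V n} (hu : u ∈ S)
    (H : IsLift Φ Φ' S' h u) (hi : LinearIndependent ℝ ![u, h u]) {e : V n}
    (he : e ∉ Submodule.span ℝ ({u, h u} : Set (V n))) :
    fderiv ℝ h u e ∈ Submodule.span ℝ ({h u, e} : Set (V n)) := by
  by_contra hX
  obtain ⟨ℓ, hℓ, hℓ0⟩ := exists_functional_of_notMem _ hX
  have hℓv : ℓ (h u) = 0 := hℓ0 _ (Submodule.subset_span (by simp))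
  have hℓe : ℓ e = 0 := hℓ0 _ (Submodule.subset_span (by simp))
  have hi3 : LinearIndependent ℝ ![e, u, h u] := by
    refine LinearIndependent.finCons hi ?_
    simpa [Matrix.range_cons, Set.insert_comm, Set.pair_comm] using he
  obtain ⟨t, ht, htX⟩ : ∃ t : ℝ, t ≠ 0 ∧
      ℓ (fderiv ℝ h u (h u)) ≠ t * ℓ (fderiv ℝ h u e) := by
    by_cases h1 : ℓ (fderiv ℝ h u (h u)) = 1 * ℓ (fderiv ℝ h u e)
    · refine ⟨2, two_ne_zero, fun h2 => hℓ ?_⟩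
      linarith
    · exact ⟨1, one_ne_zero, h1⟩
  obtain ⟨p, hp⟩ := exists_functional_of_linearIndependent hi3 ![0, 0, 1]
  obtain ⟨q, hq⟩ := exists_functional_of_linearIndependent hi3 ![1, 0, t]
  have p0 : p e = 0 := by simpa using hp 0
  have p1 : p u = 0 := by simpa using hp 1
  have p2 : p (h u) = 1 := by simpa using hp 2
  have q0 : q e = 1 := by simpa using hq 0
  have q1 : q u = 0 := by simpa using hq 1
  have q2 : q (h u) = t := by simpa using hq 2
  have key := H.fderiv_mul_eq_zero hR D D' hu (p := p) (q := q) (ℓ := ℓ) (e := h u - t • e) (f := e)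
    ht (by simp) (by simp [p0, p2]) p0 (by simp [q0, q2]) q0 p1 q1 (by simp [hℓv, hℓe]) hℓe
  rcases mul_eq_zero.1 key with h1 | h1
  · apply htX
    simpa [sub_eq_zero] using h1
  · exact hℓ h1

lemma IsLift.fderiv_eq_smul (hn : 3 ≤ n) (hR : Recurrent Γ) (D : IsDeveloping Γ ρ S Φ)
    (D' : IsDeveloping Γ ρ S' Φ') {h : V n → V n} {u : V n} (hu : u ∈ S)
    (H : IsLift Φ Φ' S' h u) (hi : LinearIndependent ℝ ![u, h u]) :
    ∃ c : ℝ, c ≠ 0 ∧ fderiv ℝ h u = c • ContinuousLinearMap.id ℝ (V n) := by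
  obtain ⟨k, hk, K, hkh, hhk⟩ := D.exists_lift_inverse D' hu H
  have hv := H.2.self_of_nhds.1
  set X := fderiv ℝ h u with hX
  set Y := fderiv ℝ k (h u) with hY
  have hdX : HasFDerivAt h X u := H.1.differentiableAt.hasFDerivAt
  have hdY : HasFDerivAt k Y (h u) := K.1.differentiableAt.hasFDerivAt
  have hYX : ∀ x, Y (X x) = x := by
    have h1 := hdY.comp u hdX
    have h2 : HasFDerivAt (k ∘ h) (ContinuousLinearMap.id ℝ (V n)) u :=
      (hasFDerivAt_id u).congr_of_eventuallyEq hkh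
    intro x
    exact DFunLike.congr_fun (h1.unique h2) x
  have hXY : ∀ x, X (Y x) = x := by
    have hdX' : HasFDerivAt h X (k (h u)) := by rwa [hk]
    have h1 := hdX'.comp (h u) hdY
    have h2 : HasFDerivAt (h ∘ k) (ContinuousLinearMap.id ℝ (V n)) (h u) :=
      (hasFDerivAt_id (h u)).congr_of_eventuallyEq hhk
    intro x
    exact DFunLike.congr_fun (h1.unique h2) x
  obtain ⟨f, hf, hfW⟩ := exists_functional_vanishing _ (span_pair_ne_top hn u (h u))
  have hfX : f.comp X ≠ 0 := by
    intro h0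
    obtain ⟨z, hz⟩ := ContinuousLinearMap.exists_ne_zero hf
    apply hz
    rw [← hXY z]
    exact DFunLike.congr_fun h0 (Y z)
  have hdense : Dense ({x | f x ≠ 0} ∩ {x | (f.comp X) x ≠ 0}) :=
    (dense_functional_ne hf).inter_of_isOpen_left (dense_functional_ne hfX)
      (isOpen_functional_ne f)
  have hgen : ∀ e, f e ≠ 0 → f (X e) ≠ 0 → ¬ LinearIndependent ℝ ![e, X e] := by
    intro e he he' hli
    have heW : e ∉ Submodule.span ℝ ({u, h u} : Set (V n)) := fun hm => he (hfW _ hm)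
    have heW' : X e ∉ Submodule.span ℝ ({u, h u} : Set (V n)) := fun hm => he' (hfW _ hm)
    obtain ⟨a, b, hab⟩ := Submodule.mem_span_pair.1 (H.fderiv_mem_span hR D D' hu hi heW)
    have hi' : LinearIndependent ℝ ![h u, k (h u)] := by
      rw [hk]; exact LinearIndependent.pair_symm_iff.1 hi
    have h2 := K.fderiv_mem_span hR D' D hv hi' (e := X e)
      (by rw [hk]; rwa [Set.pair_comm])
    rw [hk, ← hY, hYX] at h2
    obtain ⟨c, d, hcd⟩ := Submodule.mem_span_pair.1 h2
    rw [← hX] at hab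
    have hi3 : LinearIndependent ℝ ![e, u, h u] := by
      refine LinearIndependent.finCons hi ?_
      simpa [Matrix.range_cons, Set.insert_comm, Set.pair_comm] using heW
    have h3 : (d * b - 1) • e + c • u + (d * a) • h u = 0 := by
      rw [← hab] at hcd
      have := sub_eq_zero.2 hcd
      rw [← this]; module
    have h4 := Fintype.linearIndependent_iff.1 hi3 ![d * b - 1, c, d * a] (by
      simpa [Fin.sum_univ_three] using h3)
    have h40 : d * b - 1 = 0 := by simpa using h4 0
    have h42 : d * a = 0 := by simpa using h4 2
    have hd : d ≠ 0 := by rintro rfl; simp at h40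
    have ha : a = 0 := (mul_eq_zero.1 h42).resolve_left hd
    rw [ha, zero_smul, zero_add] at hab
    rw [LinearIndependent.pair_iff] at hli
    have := hli b (-1) (by rw [hab]; simp)
    norm_num at this
  have hall : ∀ e, ¬ LinearIndependent ℝ ![e, X e] := by
    intro e hli
    have hopen : IsOpen {x : V n | LinearIndependent ℝ ![x, X x]} := by
      refine (isOpen_setOfPred_linearIndependent (𝕜 := ℝ) (E := V n) (ι := Fin 2)).preimage
        (f := fun x : V n => ![x, X x]) ?_
      refine continuous_pi fun i => ?_
      fin_cases i
      · exact continuous_id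
      · exact X.continuous
    obtain ⟨x, hx1, hx2, hx3⟩ := hdense.inter_open_nonempty _ hopen ⟨e, hli⟩
    exact hgen x hx2 hx3 hx1
  obtain ⟨c, hc⟩ := LinearMap.exists_eq_smul_id_of_forall_notLinearIndependent
    (f := (X : V n →ₗ[ℝ] V n)) hall
  have hc' : X = c • ContinuousLinearMap.id ℝ (V n) := by
    ext1 x
    have := LinearMap.congr_fun hc x
    simpa using this
  refine ⟨c, ?_, hc'⟩
  rintro rfl
  apply hfX
  rw [hc']; simp

end

lemma eventually_nhds_eq_of_dense {n : ℕ} {h k : V n → V n} {u : V n} {s : Set (V n)}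
    (hs : Dense s) (hh : ∀ᶠ x in 𝓝 u, ContinuousAt h x) (hk : Continuous k)
    (he : ∀ᶠ x in 𝓝 u, x ∈ s → h x = k x) : ∀ᶠ x in 𝓝 u, h x = k x := by
  filter_upwards [hh, he.eventually_nhds] with x h1 h2
  have : (𝓝[s] x).NeBot := mem_closure_iff_nhdsWithin_neBot.1 (hs x)
  refine tendsto_nhds_unique_of_eventuallyEq (l := 𝓝[s] x) (h1.tendsto.mono_left nhdsWithin_le_nhds)
    (hk.continuousAt.tendsto.mono_left nhdsWithin_le_nhds) ?_
  exact eventually_nhdsWithin_iff.2 h2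

section

variable {n : ℕ} {M : Type*} [TopologicalSpace M] [ChartedSpace (V n) M]
    {Γ : Subgroup (SLR n)} {ρ : Γ →* Equiv.Perm M} {S S' : Set (V n)} {Φ Φ' : V n → M}

lemma exists_affine_of_fderiv_eq_smul (hn : 3 ≤ n) {h : V n → V n} {u : V n}
    (ha : AnalyticAt ℝ h u)
    (hd : ∀ᶠ x in 𝓝 u, ∃ c : ℝ, c ≠ 0 ∧ fderiv ℝ h x = c • ContinuousLinearMap.id ℝ (V n)) :
    ∃ c : ℝ, c ≠ 0 ∧ ∃ b : V n, ∀ᶠ x in 𝓝 u, h x = c • x + b := by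
  obtain ⟨ε, hε, hB⟩ := Metric.eventually_nhds_iff_ball.1 (hd.and ha.eventually_analyticAt)
  have hpre : IsPreconnected (Metric.ball u ε) := (convex_ball u ε).isPreconnected
  have hu : u ∈ Metric.ball u ε := Metric.mem_ball_self hε
  let z : V n := fun _ => 1
  let i0 : Fin n := ⟨0, by omega⟩
  let c : V n → ℝ := fun x => fderiv ℝ h x z i0
  have hc : ∀ x ∈ Metric.ball u ε, c x ≠ 0 ∧ fderiv ℝ h x = c x • ContinuousLinearMap.id ℝ (V n) := by
    intro x hx
    obtain ⟨⟨a, ha0, ha⟩, -⟩ := hB x hx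
    have : c x = a := by simp [c, ha, z]
    rw [this]; exact ⟨ha0, ha⟩
  have hdF : ∀ x ∈ Metric.ball u ε, DifferentiableAt ℝ (fderiv ℝ h) x := fun x hx =>
    (hB x hx).2.fderiv.differentiableAt
  have hdc : ∀ x ∈ Metric.ball u ε, DifferentiableAt ℝ c x := by
    intro x hx
    have h1 : DifferentiableAt ℝ (fun x => fderiv ℝ h x z) x :=
      (hdF x hx).clm_apply (differentiableAt_const z)
    exact differentiableAt_pi.1 h1 i0
  have hzero : ∀ x ∈ Metric.ball u ε, fderiv ℝ c x = 0 := by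
    intro x hx
    have hsym : IsSymmSndFDerivAt ℝ h x :=
      ((hB x hx).2.contDiffAt (n := 2)).isSymmSndFDerivAt (by simp)
    have hF : fderiv ℝ (fderiv ℝ h) x =
        fderiv ℝ (fun y => c y • ContinuousLinearMap.id ℝ (V n)) x := by
      refine Filter.EventuallyEq.fderiv_eq ?_
      filter_upwards [Metric.isOpen_ball.mem_nhds hx] with y hy using (hc y hy).2
    have hF' : ∀ a b, fderiv ℝ (fderiv ℝ h) x a b = fderiv ℝ c x a • b := by
      intro a b
      have h1 : fderiv ℝ (fun y => c y • ContinuousLinearMap.id ℝ (V n)) x = _ :=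
        ((hdc x hx).hasFDerivAt.smul_const (ContinuousLinearMap.id ℝ (V n))).fderiv
      rw [hF, h1]
      simp
    ext1 a
    obtain ⟨f, hf, hfW⟩ := exists_functional_vanishing _ (span_pair_ne_top hn a a)
    obtain ⟨b, hb⟩ := ContinuousLinearMap.exists_ne_zero hf
    have := congrArg f (hsym a b)
    rw [hF', hF', map_smul, map_smul, hfW a (Submodule.subset_span (by simp))] at this
    simpa [hb] using this
  obtain ⟨a, ha⟩ := Metric.isOpen_ball.exists_is_const_of_fderiv_eq_zero hpre
    (fun x hx => (hdc x hx).differentiableWithinAt) hzero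
  obtain ⟨b, hb⟩ := Metric.isOpen_ball.exists_eq_add_of_fderiv_eq (f := h) (g := fun x => a • x)
    hpre (fun x hx => (hB x hx).2.differentiableAt.differentiableWithinAt)
    (fun x hx => (differentiableAt_id.const_smul a).differentiableWithinAt) (by
      intro x hx
      rw [(hc x hx).2, ha x hx]
      exact ((hasFDerivAt_id x).const_smul a).fderiv.symm)
  refine ⟨a, ha u hu ▸ (hc u hu).1, b, ?_⟩
  filter_upwards [Metric.ball_mem_nhds u hε] with x hx using hb hx

lemma IsLift.eq_smul_of_parallel (hn : 3 ≤ n) (hR : Recurrent Γ) (D : IsDeveloping Γ ρ S Φ)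
    (D' : IsDeveloping Γ ρ S' Φ') {h : V n → V n} {u : V n} (hu : u ∈ S)
    (hu0 : u ≠ 0) (H : IsLift Φ Φ' S' h u) (hp : ∀ᶠ x in 𝓝 u, ∃ c : ℝ, h x = c • x) :
    ∃ c : ℝ, ∀ᶠ x in 𝓝 u, h x = c • x := by
  obtain ⟨c₀, hc₀⟩ := hp.self_of_nhds
  refine ⟨c₀, ?_⟩
  obtain ⟨f₀, hf₀, hfW⟩ := exists_functional_vanishing _ (span_pair_ne_top hn u u)
  have hfu : f₀ u = 0 := hfW u (Submodule.subset_span (by simp))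
  refine eventually_nhds_eq_of_dense (dense_functional_ne hf₀)
    (H.eventually.mono fun x hx => hx.1.continuousAt) (continuous_const_smul c₀) ?_
  filter_upwards [H.eventually.eventually_nhds, hp.eventually_nhds, D.eventually_mem hu,
    (D.eventually_mem hu).eventually_nhds] with y hHy hpy hyS hyS' hy
  change f₀ y ≠ 0 at hy
  have hi : LinearIndependent ℝ ![y - u, u] := by
    rw [LinearIndependent.pair_symm_iff, LinearIndependent.pair_iff' hu0]
    intro a ha
    have := congrArg f₀ ha
    simp [hfu] at this
    exact hy this.symm
  obtain ⟨f₁, hf₁, hfW₁⟩ := exists_functional_vanishing _ (span_pair_ne_top hn (y - u) u)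
  obtain ⟨m, hm⟩ := ContinuousLinearMap.exists_ne_zero hf₁
  have hi3 : LinearIndependent ℝ ![m, y - u, u] := by
    refine LinearIndependent.finCons hi fun hmem => hm (hfW₁ m ?_)
    simpa [Matrix.range_cons, Set.insert_comm, Set.pair_comm] using hmem
  obtain ⟨p, hp'⟩ := exists_functional_of_linearIndependent hi3 ![1, 0, 0]
  obtain ⟨q, hq'⟩ := exists_functional_of_linearIndependent hi3 ![0, 1, 0]
  have p0 : p m = 1 := by simpa using hp' 0
  have p1 : p (y - u) = 0 := by simpa using hp' 1
  have p2 : p u = 0 := by simpa using hp' 2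
  have q0 : q m = 0 := by simpa using hq' 0
  have q1 : q (y - u) = 1 := by simpa using hq' 1
  have q2 : q u = 0 := by simpa using hq' 2
  have p3 : p y = 0 := by simpa [p2] using p1
  have q3 : q y = 1 := by simpa [q2] using q1
  obtain ⟨g, g', κ, γ, hg, hg', hκ, hγ⟩ := hR.hyperbolic p q m (y - u) p0 p1 q0 q1
  have tpow : Tendsto (fun j => (1 / 2 : ℝ) ^ κ j) atTop (𝓝 0) :=
    (tendsto_pow_atTop_nhds_zero_of_lt_one (by norm_num) (by norm_num)).comp hκ
  have tw : Tendsto (fun j => lact (g j)⁻¹ y) atTop (𝓝 y) :=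
    tendsto_lact_one (tendsto_inv_one hg) tendsto_const_nhds
  have tx : Tendsto (fun j => lact (γ j : SLR n) (lact (g j)⁻¹ y)) atTop (𝓝 u) := by
    have h1 : Tendsto (fun j => lact (g' j)⁻¹ (u + (1 / 2 : ℝ) ^ κ j • (y - u))) atTop
        (𝓝 (u + (0 : ℝ) • (y - u))) :=
      tendsto_lact_one (tendsto_inv_one hg') (tendsto_const_nhds.add (tpow.smul_const _))
    rw [zero_smul, add_zero] at h1
    refine h1.congr fun j => ?_
    rw [hγ, lact_lact_inv, p3, q3]
    congr 1; simp
  have hpar : ∀ᶠ j in atTop, h (lact (γ j : SLR n) (lact (g j)⁻¹ y)) =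
      lact (γ j : SLR n) (h (lact (g j)⁻¹ y)) := by
    filter_upwards [tw.eventually (hHy.and (hyS'.and hpy.eventually_nhds)),
      tx.eventually (H.eventually.and hp.eventually_nhds)]
      with j ⟨hj1, hj2, hj3⟩ ⟨hj4, hj5⟩
    obtain ⟨ℓ, hℓ, hℓW⟩ := exists_functional_vanishing _ (span_pair_ne_top hn
      (lact (γ j : SLR n) (lact (g j)⁻¹ y)) (lact (γ j : SLR n) (lact (g j)⁻¹ y)))
    have hj6 := hj1.conj D D' hj2 (γ j)
    have hback : Tendsto (fun x => lact (γ j : SLR n)⁻¹ x)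
        (𝓝 (lact (γ j : SLR n) (lact (g j)⁻¹ y))) (𝓝 (lact (g j)⁻¹ y)) := by
      have := (act (γ j : SLR n)⁻¹).continuous.tendsto (lact (γ j : SLR n) (lact (g j)⁻¹ y))
      rwa [act_apply, lact_inv_lact] at this
    have := D'.eq_of_parallel hR (h₁ := h)
      (h₂ := fun x => lact (γ j : SLR n) (h (lact (γ j : SLR n)⁻¹ x)))
      hj4.1.continuousAt hj6.1.continuousAt ?_ ?_ ℓ hℓ (hℓW _ (Submodule.subset_span (by simp)))
    · rw [this, lact_inv_lact]
    · filter_upwards [hj4.2, hj6.2] with x a1 a2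
      exact ⟨a1.1, a2.1, a1.2.trans a2.2.symm⟩
    · filter_upwards [hj5, hback.eventually hj3] with x a1 a2
      refine ⟨a1, ?_⟩
      obtain ⟨c, hc⟩ := a2
      exact ⟨c, by rw [hc, lact_smul, lact_lact_inv]⟩
  have hcy := hHy.self_of_nhds.1.continuousAt
  obtain ⟨cy, hcy'⟩ := hpy.self_of_nhds
  have tr : Tendsto (fun j => f₀ (h (lact (g j)⁻¹ y)) / f₀ (lact (g j)⁻¹ y)) atTop
      (𝓝 (f₀ (h y) / f₀ y)) :=
    ((f₀.continuous.tendsto _).comp (hcy.tendsto.comp tw)).div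
      ((f₀.continuous.tendsto _).comp tw) hy
  have hr : f₀ (h y) / f₀ y = cy := by rw [hcy', map_smul, smul_eq_mul, mul_div_cancel_right₀ _ hy]
  rw [hr] at tr
  have hlim : h u = cy • u := by
    refine tendsto_nhds_unique_of_eventuallyEq (H.1.continuousAt.tendsto.comp tx) (tr.smul tx) ?_
    filter_upwards [hpar, tw.eventually hpy,
      ((f₀.continuous.tendsto _).comp tw).eventually_ne hy] with j h1 h2 h3
    obtain ⟨s, hs⟩ := h2
    simp only [Function.comp_apply] at h3 ⊢
    rw [h1, hs, map_smul, smul_eq_mul, mul_div_cancel_right₀ _ h3, lact_smul]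
  have : c₀ = cy := smul_left_injective ℝ hu0 (hc₀.symm.trans hlim)
  rw [hcy', this]

lemma IsDeveloping.exists_affine_lift (hn : 3 ≤ n) (hR : Recurrent Γ) (D : IsDeveloping Γ ρ S Φ)
    (D' : IsDeveloping Γ ρ S' Φ') {u v : V n} (hu : u ∈ S) (hv : v ∈ S') (he : Φ u = Φ' v) :
    ∃ c : ℝ, c ≠ 0 ∧ ∃ b : V n, ∃ x ∈ S,
      ∀ᶠ y in 𝓝 x, c • y + b ∈ S' ∧ Φ' (c • y + b) = Φ y := by
  have : Nonempty (Fin n) := ⟨⟨0, by omega⟩⟩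
  obtain ⟨h, -, H⟩ := D.exists_isLift D' hu hv he
  have hev := H.eventually.and (D.eventually_mem hu)
  by_cases hex : ∃ᶠ x in 𝓝 u, LinearIndependent ℝ ![x, h x]
  · obtain ⟨x, hx, Hx, hxS⟩ := (hex.and_eventually hev).exists
    have hopen : ∀ᶠ y in 𝓝 x, LinearIndependent ℝ ![y, h y] := by
      have hc : ContinuousAt (fun y => ![y, h y]) x := by
        refine continuousAt_pi.2 fun i => ?_
        fin_cases i
        · exact continuousAt_id
        · exact Hx.1.continuousAt
      exact hc.eventually (isOpen_setOfPred_linearIndependent.mem_nhds hx)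
    obtain ⟨c, hc, b, hb⟩ := exists_affine_of_fderiv_eq_smul hn Hx.1 (by
      filter_upwards [hopen, Hx.eventually, D.eventually_mem hxS] with y h1 h2 h3
      exact h2.fderiv_eq_smul hn hR D D' h3 h1)
    refine ⟨c, hc, b, x, hxS, ?_⟩
    filter_upwards [hb, Hx.2] with y h1 h2
    rwa [← h1]
  · rw [not_frequently] at hex
    obtain ⟨x, hx0, ⟨Hx, hxS⟩, hx⟩ := ((dense_compl_singleton (0 : V n)).inter_nhds_nonempty
      (hev.and hex.eventually_nhds))
    have hx0 : x ≠ 0 := hx0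
    obtain ⟨c, hc⟩ := Hx.eq_smul_of_parallel hn hR D D' hxS hx0 (by
      filter_upwards [hx, isOpen_compl_singleton.mem_nhds hx0] with y h1 h2
      rw [LinearIndependent.pair_iff' h2] at h1
      push Not at h1
      obtain ⟨a, ha⟩ := h1
      exact ⟨a, ha.symm⟩)
    refine ⟨c, ?_, 0, x, hxS, ?_⟩
    · rintro rfl
      obtain ⟨k, -, -, hk, -⟩ := D.exists_lift_inverse D' hxS Hx
      have : ∀ᶠ y in 𝓝 x, y = k 0 := by
        filter_upwards [hc, hk] with y h1 h2
        rw [← h2, h1, zero_smul]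
      have h1 : (𝓝[≠] x).NeBot := inferInstance
      have h2 : ∀ᶠ y in 𝓝[≠] x, y ≠ x := eventually_mem_nhdsWithin
      obtain ⟨y, h3, h4⟩ := (h2.and (this.filter_mono nhdsWithin_le_nhds)).exists
      exact h3 (h4.trans this.self_of_nhds.symm)
    · filter_upwards [hc, Hx.2] with y h1 h2
      rwa [add_zero, ← h1]

end

lemma exists_forall_apply_eq {n : ℕ} {ι : Type*} [Finite ι] {f : ι → V n →L[ℝ] ℝ}
    (hf : LinearIndependent ℝ f) (a : ι → ℝ) : ∃ x : V n, ∀ i, f i x = a i := by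
  have h1 : LinearIndependent ℝ (fun i => (f i : V n → ℝ)) := by
    refine hf.map' (LinearMap.ltoFun ℝ (V n) ℝ ℝ ∘ₗ ContinuousLinearMap.coeLM ℝ) ?_
    rw [LinearMap.ker_eq_bot]
    intro f g h
    exact DFunLike.coe_injective h
  rw [← span_flip_eq_top_iff_linearIndependent] at h1
  have h2 : a ∈ Submodule.span ℝ (range (flip fun i => (f i : V n → ℝ))) := h1 ▸ Submodule.mem_top
  have h3 : Submodule.span ℝ (range (flip fun i => (f i : V n → ℝ))) ≤
      LinearMap.range (LinearMap.pi fun i => (f i : V n →ₗ[ℝ] ℝ)) := by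
    rw [Submodule.span_le]
    rintro _ ⟨x, rfl⟩
    exact ⟨x, rfl⟩
  obtain ⟨x, hx⟩ := h3 h2
  exact ⟨x, fun i => congrFun hx i⟩

lemma finrank_functionals (n : ℕ) : Module.finrank ℝ (V n →L[ℝ] ℝ) = n := by
  rw [← (LinearMap.toContinuousLinearMap (𝕜 := ℝ) (E := V n) (F' := ℝ)).finrank_eq,
    Module.finrank_linearMap_self, Module.finrank_fin_fun]

lemma Submodule.isOpen_dense_compl {E : Type*} [NormedAddCommGroup E] [NormedSpace ℝ E]
    [FiniteDimensional ℝ E] {W : Submodule ℝ E} (hW : W ≠ ⊤) :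
    IsOpen (W : Set E)ᶜ ∧ Dense (W : Set E)ᶜ := by
  refine ⟨W.closed_of_finiteDimensional.isOpen_compl, ?_⟩
  rw [← interior_eq_empty_iff_dense_compl, ← not_nonempty_iff_eq_empty]
  exact fun h => hW (W.eq_top_of_nonempty_interior' h)

lemma linearIndependent_triple {E : Type*} [AddCommGroup E] [Module ℝ E] {x y z : E}
    (h : LinearIndependent ℝ ![y, z]) (hx : x ∉ Submodule.span ℝ ({y, z} : Set E)) :
    LinearIndependent ℝ ![x, y, z] := by
  refine LinearIndependent.finCons h ?_
  simpa [Matrix.range_cons, Set.insert_comm, Set.pair_comm] using hx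

lemma linearIndependent_pair_of_notMem {E : Type*} [AddCommGroup E] [Module ℝ E] {x y z : E}
    (hy : y ≠ 0) (hx : x ∉ Submodule.span ℝ ({y, z} : Set E)) :
    LinearIndependent ℝ ![y, x] := by
  rw [LinearIndependent.pair_iff' hy]
  rintro a rfl
  exact hx (Submodule.smul_mem _ _ (Submodule.subset_span (by simp)))

/-- Slices of codimension two cut out by functionals from two dense families are dense. -/
lemma exists_mem_slice {n : ℕ} (hn : 3 ≤ n) {K K' : Set (V n →L[ℝ] ℝ)} (hK : Dense K)
    (hK' : Dense K') (c : ℝ) (hc : c ≠ 0) (b x : V n) {O : Set (V n)} (hO : O ∈ 𝓝 x) :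
    ∃ ℓ ∈ K, ∃ ℓ' ∈ K', LinearIndependent ℝ ![ℓ, ℓ'] ∧ ∃ y ∈ O, ℓ y = 0 ∧ ℓ' (c • y + b) = 0 := by
  obtain ⟨f', hf', hfW'⟩ := exists_functional_vanishing _ (span_pair_ne_top hn x (c • x + b))
  obtain ⟨z, hz⟩ := ContinuousLinearMap.exists_ne_zero hf'
  obtain ⟨f, hf, hfW⟩ := exists_functional_vanishing _ (span_pair_ne_top hn x z)
  have hfx : f x = 0 := hfW x (Submodule.subset_span (by simp))
  have hfz : f z = 0 := hfW z (Submodule.subset_span (by simp))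
  have hfx' : f' (c • x + b) = 0 := hfW' _ (Submodule.subset_span (by simp))
  have hli : LinearIndependent ℝ ![f, f'] := by
    rw [LinearIndependent.pair_iff' hf]
    rintro a rfl
    simp [hfz] at hz
  let F : ((V n →L[ℝ] ℝ) × (V n →L[ℝ] ℝ)) × V n → ((V n →L[ℝ] ℝ) × (V n →L[ℝ] ℝ)) × (ℝ × ℝ) :=
    fun w => (w.1, (w.1.1 w.2, w.1.2 (c • w.2 + b)))
  have e1 : HasStrictFDerivAt (fun w : ((V n →L[ℝ] ℝ) × (V n →L[ℝ] ℝ)) × V n => w.1)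
    (ContinuousLinearMap.fst ℝ _ (V n)) ((f, f'), x) := hasStrictFDerivAt_fst
  have e2 : HasStrictFDerivAt (fun w : ((V n →L[ℝ] ℝ) × (V n →L[ℝ] ℝ)) × V n => w.2)
    (ContinuousLinearMap.snd ℝ _ (V n)) ((f, f'), x) := hasStrictFDerivAt_snd
  have hF := e1.prodMk ((e1.fst.clm_apply e2).prodMk
    (e1.snd.clm_apply ((e2.const_smul c).add_const b)))
  have hmap := hF.map_nhds_eq_of_surj (by
    rw [LinearMap.range_eq_top]
    rintro ⟨⟨m, m'⟩, s, t⟩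
    obtain ⟨v, hv⟩ := exists_forall_apply_eq hli ![s - m x, c⁻¹ * (t - m' (c • x + b))]
    have hv0 : f v = s - m x := by simpa using hv 0
    have hv1 : f' v = c⁻¹ * (t - m' (c • x + b)) := by simpa using hv 1
    refine ⟨((m, m'), v), ?_⟩
    simp [hv0, hv1]
    field_simp
    ring)
  have hN : ∀ᶠ w in 𝓝 ((f, f'), x), w.2 ∈ O ∧ LinearIndependent ℝ ![w.1.1, w.1.2] := by
    refine (continuous_snd.tendsto ((f, f'), x)).eventually hO |>.and ?_
    have hcont : Continuous (fun w : ((V n →L[ℝ] ℝ) × (V n →L[ℝ] ℝ)) × V n =>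
        ![w.1.1, w.1.2]) := by
      refine continuous_pi fun i => ?_
      fin_cases i
      · exact continuous_fst.fst
      · exact continuous_fst.snd
    have hop : IsOpen {g : Fin 2 → V n →L[ℝ] ℝ | LinearIndependent ℝ g} :=
      isOpen_setOfPred_linearIndependent
    exact (hop.preimage hcont).mem_nhds hli
  have hN' := image_mem_map (m := F) hN
  have hmapF : Filter.map F (𝓝 ((f, f'), x)) = 𝓝 (F ((f, f'), x)) := hmap
  rw [hmapF] at hN'
  have ht : Tendsto (fun k : (V n →L[ℝ] ℝ) × (V n →L[ℝ] ℝ) => (k, ((0 : ℝ), (0 : ℝ))))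
      (𝓝 (f, f')) (𝓝 (F ((f, f'), x))) := by
    simp only [F, hfx, hfx']
    exact tendsto_id.prodMk_nhds tendsto_const_nhds
  obtain ⟨⟨ℓ, ℓ'⟩, ⟨hℓ, hℓ'⟩, ⟨⟨m, m'⟩, y⟩, ⟨hy, hi⟩, hw⟩ :=
    (hK.prod hK').inter_nhds_nonempty (ht.eventually hN')
  simp only [F, Prod.mk.injEq] at hw
  obtain ⟨⟨rfl, rfl⟩, h1, h2⟩ := hw
  exact ⟨m, hℓ, m', hℓ', hi, y, hy, h1, h2⟩

/-- A set containing every slice it meets contains all slices by independent pairs of functionals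
as soon as it meets one of them. -/
lemma slice_subset_of_inter_nonempty {n : ℕ} (hn : 3 ≤ n) {K K' : Set (V n →L[ℝ] ℝ)} (hK : Dense K)
    (hK' : Dense K') {c : ℝ} (hc : c ≠ 0) {b : V n} {A : Set (V n)}
    (hA : ∀ ℓ ∈ K, ∀ ℓ' ∈ K', (∃ x ∈ A, ℓ x = 0 ∧ ℓ' (c • x + b) = 0) →
      ∀ x, ℓ x = 0 → ℓ' (c • x + b) = 0 → x ∈ A)
    {ℓ ℓ' m m' : V n →L[ℝ] ℝ} (hℓ : ℓ ∈ K) (hℓ' : ℓ' ∈ K') (hm : m ∈ K) (hm' : m' ∈ K')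
    (hi : LinearIndependent ℝ ![ℓ, ℓ']) (hj : LinearIndependent ℝ ![m, m'])
    (h : ∃ x ∈ A, ℓ x = 0 ∧ ℓ' (c • x + b) = 0) (x : V n) (hx : m x = 0)
    (hx' : m' (c • x + b) = 0) : x ∈ A := by
  have hfr : 3 ≤ Module.finrank ℝ (V n →L[ℝ] ℝ) := by rwa [finrank_functionals]
  have C : ∀ f g : V n →L[ℝ] ℝ, _ := fun f g =>
    Submodule.isOpen_dense_compl (span_pair_ne_top_of_finrank hfr f g)
  have back : ∀ y : V n, c • (c⁻¹ • (y - b)) + b = y := fun y => by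
    rw [smul_inv_smul₀ hc, sub_add_cancel]
  have hm0 : m ≠ 0 := hj.ne_zero 0
  have hℓ0 : ℓ ≠ 0 := hi.ne_zero 0
  have hm0' : m' ≠ 0 := hj.ne_zero 1
  obtain ⟨k', ⟨h1, h2⟩, hk'⟩ := (((C ℓ ℓ').2.inter_of_isOpen_left (C m' m).2
    (C ℓ ℓ').1).inter_of_isOpen_left hK' ((C ℓ ℓ').1.inter (C m' m).1)).nonempty
  obtain ⟨k, ⟨⟨h3, h4⟩, h5⟩, hk⟩ := ((((C ℓ k').2.inter_of_isOpen_left (C m' k').2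
    (C ℓ k').1).inter_of_isOpen_left (C m m').2
      ((C ℓ k').1.inter (C m' k').1)).inter_of_isOpen_left hK
      (((C ℓ k').1.inter (C m' k').1).inter (C m m').1)).nonempty
  have i1 := linearIndependent_triple hi h1
  have i2 := linearIndependent_triple (linearIndependent_pair_of_notMem hℓ0 h1) h3
  have i3 := linearIndependent_triple (linearIndependent_pair_of_notMem hm0' h2) h4
  have i4 := linearIndependent_triple hj h5
  obtain ⟨y1, hy1⟩ := exists_forall_apply_eq i1 ![0, ℓ b, 0]
  obtain ⟨y2, hy2⟩ := exists_forall_apply_eq i2 ![k b, ℓ b, 0]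
  obtain ⟨y3, hy3⟩ := exists_forall_apply_eq i3 ![k b, 0, 0]
  obtain ⟨y4, hy4⟩ := exists_forall_apply_eq i4 ![k b, m b, 0]
  have z : ∀ (f : V n →L[ℝ] ℝ) y, f y = f b → f (c⁻¹ • (y - b)) = 0 := fun f y hy => by
    simp [hy]
  simp only [Fin.forall_fin_succ, Fin.isValue] at hy1 hy2 hy3 hy4
  simp at hy1 hy2 hy3 hy4
  obtain ⟨a1, a2, a3⟩ := hy1
  obtain ⟨b1, b2, b3⟩ := hy2
  obtain ⟨c1, c2, c3⟩ := hy3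
  obtain ⟨d1, d2, d3⟩ := hy4
  have s1 := hA ℓ hℓ ℓ' hℓ' h (c⁻¹ • (y1 - b)) (z _ _ a2) (by rwa [back])
  have s2 := hA ℓ hℓ k' hk' ⟨_, s1, z _ _ a2, by rwa [back]⟩ (c⁻¹ • (y2 - b)) (z _ _ b2)
    (by rwa [back])
  have s3 := hA k hk k' hk' ⟨_, s2, z _ _ b1, by rwa [back]⟩ (c⁻¹ • (y3 - b)) (z _ _ c1)
    (by rwa [back])
  have s4 := hA k hk m' hm' ⟨_, s3, z _ _ c1, by rwa [back]⟩ (c⁻¹ • (y4 - b)) (z _ _ d1)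
    (by rwa [back])
  exact hA m hm m' hm' ⟨_, s4, z _ _ d2, by rwa [back]⟩ x hx hx'

section

variable {n : ℕ} {M : Type*} [TopologicalSpace M] [ChartedSpace (V n) M]
    {Γ : Subgroup (SLR n)} {ρ : Γ →* Equiv.Perm M} {S S' : Set (V n)} {Φ Φ' : V n → M}

namespace IsDeveloping

lemma dense_kernelsIn (hn : 0 < n) (hR : Recurrent Γ) (D : IsDeveloping Γ ρ S Φ) :
    Dense (kernelsIn S) :=
  hR.dense_kernelsIn hn D.isOpen D.zero_mem D.lact_mem

lemma dense (hn : 3 ≤ n) (hR : Recurrent Γ) (D : IsDeveloping Γ ρ S Φ) : Dense S := by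
  have hK := D.dense_kernelsIn (by omega) hR
  intro x
  rw [mem_closure_iff_nhds]
  intro O hO
  obtain ⟨ℓ, hℓ, -, -, -, y, hy, h0, -⟩ := exists_mem_slice hn hK hK 1 one_ne_zero 0 x hO
  exact ⟨y, hy, hℓ y h0⟩

/-- The agreement set of `Φ` with `Φ'` precomposed with an affine map is relatively closed. -/
lemma eventually_eq_of_frequently [T2Space M] (D : IsDeveloping Γ ρ S Φ)
    (D' : IsDeveloping Γ ρ S' Φ') {c : ℝ} {b x : V n} (hx : x ∈ S) (hx' : c • x + b ∈ S')
    (hf : ∃ᶠ z in 𝓝 x, ∀ᶠ y in 𝓝 z, Φ' (c • y + b) = Φ y) :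
    ∀ᶠ y in 𝓝 x, Φ' (c • y + b) = Φ y := by
  have hcont : Continuous fun y : V n => c • y + b := by fun_prop
  have hc : ContinuousAt (fun y => Φ' (c • y + b)) x :=
    ContinuousAt.comp (f := fun y => c • y + b) (D'.cAnalyticAt hx').1 hcont.continuousAt
  have he : Φ' (c • x + b) = Φ x :=
    tendsto_nhds_unique_of_frequently_eq hc.tendsto (D.cAnalyticAt hx).1.tendsto
      (hf.mono fun z hz => hz.self_of_nhds)
  obtain ⟨h, hh, H⟩ := D.exists_isLift D' hx hx' he.symm
  obtain ⟨U, hU, hinj⟩ := D'.exists_injOn hx'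
  have hU1 : ∀ᶠ y in 𝓝 x, c • y + b ∈ U := hcont.continuousAt.eventually hU
  have hU2 : ∀ᶠ y in 𝓝 x, h y ∈ U := H.1.continuousAt.eventually (by rwa [hh])
  obtain ⟨ε, hε, hB⟩ := Metric.eventually_nhds_iff_ball.1
    (H.1.eventually_analyticAt.and (H.2.and (hU1.and hU2)))
  obtain ⟨a, ha, haB⟩ := (hf.and_eventually (Metric.ball_mem_nhds x hε)).exists
  have heq : EqOn h (fun y => c • y + b) (Metric.ball x ε) := by
    refine AnalyticOnNhd.eqOn_of_preconnected_of_eventuallyEq (𝕜 := ℝ) (fun y hy => (hB y hy).1)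
      (fun y _ => ?_) (convex_ball x ε).isPreconnected haB ?_
    · exact ((c • ContinuousLinearMap.id ℝ (V n)).analyticAt y).add analyticAt_const
    · filter_upwards [ha, Metric.isOpen_ball.mem_nhds haB] with y h1 h2
      obtain ⟨-, ⟨-, h3⟩, h4, h5⟩ := hB y h2
      exact hinj h5 h4 (h3.trans h1.symm)
  filter_upwards [Metric.ball_mem_nhds x hε] with y hy
  rw [← (hB y hy).2.1.2, heq hy]

/-- If `Φ` agrees somewhere locally with `Φ'` precomposed with an affine map, then it does so
wherever this makes sense. -/
lemma eq_of_eventually_eq [T2Space M] (hn : 3 ≤ n) (hR : Recurrent Γ) (D : IsDeveloping Γ ρ S Φ)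
    (D' : IsDeveloping Γ ρ S' Φ') {c : ℝ} (hc : c ≠ 0) {b : V n}
    (he : ∃ x ∈ S, ∀ᶠ y in 𝓝 x, c • y + b ∈ S' ∧ Φ' (c • y + b) = Φ y) {x : V n} (hx : x ∈ S)
    (hx' : c • x + b ∈ S') : Φ' (c • x + b) = Φ x := by
  have hcont : Continuous fun y : V n => c • y + b := by fun_prop
  set A : Set (V n) := {x | ∀ᶠ y in 𝓝 x, Φ' (c • y + b) = Φ y} with hA
  have hAo : IsOpen A := isOpen_setOfPred_eventually_nhds
  have hAc : ∀ x ∈ S, c • x + b ∈ S' → x ∈ closure A → x ∈ A := fun x h1 h2 h3 =>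
    D.eventually_eq_of_frequently D' h1 h2 (mem_closure_iff_frequently.1 h3)
  have hK := D.dense_kernelsIn (by omega) hR
  have hK' := D'.dense_kernelsIn (by omega) hR
  have hpiece : ∀ ℓ ∈ kernelsIn S, ∀ ℓ' ∈ kernelsIn S',
      (∃ x ∈ A, ℓ x = 0 ∧ ℓ' (c • x + b) = 0) → ∀ x, ℓ x = 0 → ℓ' (c • x + b) = 0 → x ∈ A := by
    rintro ℓ hℓ ℓ' hℓ' ⟨y, hyA, hy, hy'⟩ x hx hx'
    have hconv : Convex ℝ {x : V n | ℓ x = 0 ∧ ℓ' (c • x + b) = 0} := by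
      rintro u ⟨hu, hu'⟩ v ⟨hv, hv'⟩ s t - - hst
      refine ⟨by simp [hu, hv], ?_⟩
      have : c • (s • u + t • v) + b = s • (c • u + b) + t • (c • v + b) := by
        obtain rfl : t = 1 - s := by linarith
        module
      rw [this, map_add, map_smul, map_smul, hu', hv']
      simp
    refine hconv.isPreconnected.subset_of_closure_inter_subset hAo ⟨y, ⟨hy, hy'⟩, hyA⟩ ?_ ⟨hx, hx'⟩
    rintro z ⟨hzA, hz, hz'⟩
    exact hAc z (hℓ z hz) (hℓ' _ hz') hzA
  obtain ⟨x₀, hx₀, he₀⟩ := he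
  obtain ⟨ℓ, hℓ, ℓ', hℓ', hi, y, hyA, hy, hy'⟩ := exists_mem_slice hn hK hK' c hc b x₀
    (hAo.mem_nhds (show x₀ ∈ A from he₀.mono fun y hy => hy.2))
  have hxA : x ∈ A := by
    refine hAc x hx hx' (mem_closure_iff_nhds.2 fun O hO => ?_)
    obtain ⟨m, hm, m', hm', hj, z, hzO, hz, hz'⟩ := exists_mem_slice hn hK hK' c hc b x hO
    exact ⟨z, hzO, slice_subset_of_inter_nonempty hn hK hK' hc hpiece hℓ hℓ' hm hm' hi hj
      ⟨y, hyA, hy, hy'⟩ z hz hz'⟩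
  exact hxA.self_of_nhds

end IsDeveloping

lemma CAnalyticAt.congr {f g : V n → M} {x : V n} (hf : CAnalyticAt (V n) (V n) f x)
    (h : f =ᶠ[𝓝 x] g) : CAnalyticAt (V n) (V n) g x := by
  refine ⟨hf.1.congr h, ?_⟩
  have := hf.2
  rw [h.self_of_nhds] at this
  refine this.congr ?_
  simp only [chartAt_self_eq, OpenPartialHomeomorph.refl_symm, OpenPartialHomeomorph.refl_apply]
  filter_upwards [h] with y hy
  simp [hy]

/-- Local form of being an analytic local diffeomorphism. -/
def LocalAnaDiffeoAt (f : V n → M) (s : Set (V n)) (x : V n) : Prop :=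
  ∃ U : Set (V n), IsOpen U ∧ x ∈ U ∧ U ⊆ s ∧ InjOn f U ∧ IsOpen (f '' U) ∧
    CAnalyticOn (V n) (V n) f U ∧
    ∃ g : M → V n, LeftInvOn g f U ∧ CAnalyticOn (V n) (V n) g (f '' U)

lemma LocalAnaDiffeoAt.mono {f f' : V n → M} {s t : Set (V n)} {x : V n}
    (h : LocalAnaDiffeoAt f s x) (he : EqOn f f' s) (hst : s ⊆ t) : LocalAnaDiffeoAt f' t x := by
  obtain ⟨U, hU, hxU, hUs, hinj, himg, hf, g, hg, hga⟩ := h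
  have he' := he.mono hUs
  refine ⟨U, hU, hxU, hUs.trans hst, hinj.congr he', he'.image_eq ▸ himg, fun y hy => ?_, g, ?_,
    he'.image_eq ▸ hga⟩
  · exact (hf y hy).congr (he'.eventuallyEq_of_mem (hU.mem_nhds hy))
  · intro y hy
    rw [← he' hy, hg hy]

lemma LocalAnaDiffeoAt.comp_affine {f : V n → M} {s : Set (V n)} {c : ℝ} (hc : c ≠ 0) {b x : V n}
    (h : LocalAnaDiffeoAt f s (c • x + b)) :
    LocalAnaDiffeoAt (fun y => f (c • y + b)) {y | c • y + b ∈ s} x := by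
  obtain ⟨U, hU, hxU, hUs, hinj, himg, hf, g, hg, hga⟩ := h
  have hcont : Continuous fun y : V n => c • y + b := by fun_prop
  have hsurj : ∀ y : V n, c • (c⁻¹ • (y - b)) + b = y := fun y => by
    rw [smul_inv_smul₀ hc, sub_add_cancel]
  have hleft : ∀ y : V n, c⁻¹ • (c • y + b - b) = y := fun y => by
    rw [add_sub_cancel_right, inv_smul_smul₀ hc]
  have himage : (fun y => f (c • y + b)) '' {y | c • y + b ∈ U} = f '' U := by
    ext m
    constructor
    · rintro ⟨y, hy, rfl⟩
      exact ⟨_, hy, rfl⟩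
    · rintro ⟨y, hy, rfl⟩
      exact ⟨c⁻¹ • (y - b), by simpa [hsurj] using hy, by simp [hsurj]⟩
  refine ⟨{y | c • y + b ∈ U}, hU.preimage hcont, hxU, fun y hy => hUs hy, ?_, himage ▸ himg, ?_,
    fun m => c⁻¹ • (g m - b), ?_, ?_⟩
  · intro y hy z hz hyz
    rw [← hleft y, ← hleft z, hinj hy hz hyz]
  · intro y hy
    obtain ⟨h1, h2⟩ := hf _ hy
    refine ⟨ContinuousAt.comp (f := fun y => c • y + b) h1 hcont.continuousAt, ?_⟩
    simp only [chartAt_self_eq, OpenPartialHomeomorph.refl_symm,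
      OpenPartialHomeomorph.refl_apply] at h2 ⊢
    have ha : AnalyticAt ℝ (fun y : V n => c • y + b) y :=
      ((c • ContinuousLinearMap.id ℝ (V n)).analyticAt y).add analyticAt_const
    exact AnalyticAt.fun_comp (f := fun y : V n => c • y + b) (x := y) (by exact h2) ha
  · intro y hy
    simp only [hg hy, hleft]
  · rw [himage]
    intro m hm
    obtain ⟨h1, h2⟩ := hga m hm
    refine ⟨(h1.sub continuousAt_const).const_smul c⁻¹, ?_⟩
    simp only [chartAt_self_eq, OpenPartialHomeomorph.refl_apply] at h2 ⊢
    exact (h2.sub analyticAt_const).const_smul (c := c⁻¹)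

end

section

variable {n : ℕ} {M : Type*} [TopologicalSpace M] [ChartedSpace (V n) M]
    {Γ : Subgroup (SLR n)} {ρ : Γ →* Equiv.Perm M} {S S' : Set (V n)} {Φ Φ' : V n → M}

/-- Affine changes of coordinates relating two developing maps can be conjugated by `Γ`. -/
lemma IsDeveloping.affine_conj (D : IsDeveloping Γ ρ S Φ) (D' : IsDeveloping Γ ρ S' Φ') {c : ℝ}
    {b : V n} (he : ∃ x ∈ S, ∀ᶠ y in 𝓝 x, c • y + b ∈ S' ∧ Φ' (c • y + b) = Φ y) (γ : Γ) :
    ∃ x ∈ S, ∀ᶠ y in 𝓝 x, c • y + lact (γ : SLR n) b ∈ S' ∧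
      Φ' (c • y + lact (γ : SLR n) b) = Φ y := by
  obtain ⟨x, hx, he⟩ := he
  refine ⟨lact (γ : SLR n) x, D.lact_mem γ x hx, ?_⟩
  have ht : Tendsto (fun y => lact (γ : SLR n)⁻¹ y) (𝓝 (lact (γ : SLR n) x)) (𝓝 x) := by
    have := (act (γ : SLR n)⁻¹).continuous.tendsto (lact (γ : SLR n) x)
    rwa [act_apply, lact_inv_lact] at this
  filter_upwards [ht.eventually (he.and (D.eventually_mem hx))] with y ⟨⟨h1, h2⟩, h3⟩
  have h4 : c • y + lact (γ : SLR n) b = lact (γ : SLR n) (c • lact (γ : SLR n)⁻¹ y + b) := by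
    rw [lact_add, lact_smul, lact_lact_inv]
  rw [h4]
  refine ⟨D'.lact_mem γ _ h1, ?_⟩
  rw [D'.equivariant γ _ h1, h2, ← D.equivariant γ _ h3, lact_lact_inv]

/-- A maximal developing map absorbs every developing map whose image meets its own. -/
lemma SiegelData.image_subset [T2Space M] (hn : 3 ≤ n) (hR : Recurrent Γ) {x₀ : M} {φ : V n → M}
    (hS : SiegelData Γ ρ x₀ φ S Φ) (D' : IsDeveloping Γ ρ S' Φ') (hS' : IsConnected S')
    (hmeet : (Φ '' S ∩ Set.image Φ' S').Nonempty) : Set.image Φ' S' ⊆ Φ '' S := by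
  obtain ⟨-, -, -, hG, hmax⟩ := hS
  have D := hG.isDeveloping
  obtain ⟨_, ⟨u, hu, rfl⟩, v, hv, hvu⟩ := hmeet
  obtain ⟨c, hc, b, he⟩ := D.exists_affine_lift hn hR D' hu hv hvu.symm
  have heγ := D.affine_conj D' he
  let β : Γ → V n := fun γ => lact (γ : SLR n) b
  let Q : Γ → Set (V n) := fun γ => {x | c • x + β γ ∈ S'}
  have hcont : ∀ γ, Continuous fun y : V n => c • y + β γ := fun γ => by fun_prop
  have hQ : ∀ γ, IsOpen (Q γ) := fun γ => D'.isOpen.preimage (hcont γ)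
  have hSQ : ∀ γ, ∀ x ∈ S, x ∈ Q γ → Φ' (c • x + β γ) = Φ x := fun γ x hx hx' =>
    D.eq_of_eventually_eq hn hR D' hc (heγ γ) hx hx'
  have hcQ : ∀ γ, ∀ x ∈ Q γ, ContinuousAt (fun y => Φ' (c • y + β γ)) x := fun γ x hx =>
    ContinuousAt.comp (f := fun y => c • y + β γ) (D'.cAnalyticAt hx).1 (hcont γ).continuousAt
  have hQQ : ∀ γ δ, ∀ x, x ∈ Q γ → x ∈ Q δ → Φ' (c • x + β γ) = Φ' (c • x + β δ) := by
    intro γ δ x h1 h2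
    have : (𝓝[S] x).NeBot := mem_closure_iff_nhdsWithin_neBot.1 (D.dense hn hR x)
    refine tendsto_nhds_unique_of_eventuallyEq (l := 𝓝[S] x)
      ((hcQ γ x h1).tendsto.mono_left nhdsWithin_le_nhds)
      ((hcQ δ x h2).tendsto.mono_left nhdsWithin_le_nhds) ?_
    filter_upwards [self_mem_nhdsWithin, nhdsWithin_le_nhds ((hQ γ).mem_nhds h1),
      nhdsWithin_le_nhds ((hQ δ).mem_nhds h2)] with y a1 a2 a3
    rw [hSQ γ y a1 a2, hSQ δ y a1 a3]
  classical
  let T : Set (V n) := S ∪ ⋃ γ, Q γ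
  let Ψ : V n → M := fun x =>
    if x ∈ S then Φ x else if h : ∃ γ, x ∈ Q γ then Φ' (c • x + β h.choose) else Φ x
  have hΨS : EqOn Φ Ψ S := fun x hx => by simp [Ψ, hx]
  have hΨQ : ∀ γ, EqOn (fun x => Φ' (c • x + β γ)) Ψ (Q γ) := by
    intro γ x hx
    by_cases hxS : x ∈ S
    · rw [← hΨS hxS]; exact hSQ γ x hxS hx
    · have hex : ∃ γ, x ∈ Q γ := ⟨γ, hx⟩
      simp only [Ψ, hxS, if_false, dif_pos hex]
      exact hQQ _ _ x hx hex.choose_spec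
  have hST : S ⊆ T := subset_union_left
  have hQT : ∀ γ, Q γ ⊆ T := fun γ => (subset_iUnion Q γ).trans subset_union_right
  have hlact : ∀ (γ δ : Γ) x, c • lact (δ : SLR n) x + β (δ * γ) =
      lact (δ : SLR n) (c • x + β γ) := fun γ δ x => by
    simp only [β, Subgroup.coe_mul, lact_mul, lact_add, lact_smul]
  have hQl : ∀ (γ δ : Γ), ∀ x ∈ Q γ, lact (δ : SLR n) x ∈ Q (δ * γ) := fun γ δ x hx => by
    change c • lact (δ : SLR n) x + β (δ * γ) ∈ S'
    rw [hlact]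
    exact D'.lact_mem δ _ hx
  have hQpre : ∀ γ, IsPreconnected (Q γ) := fun γ => by
    have : Q γ = (fun y => c⁻¹ • (y - β γ)) '' S' := by
      ext x
      constructor
      · intro hx
        exact ⟨_, hx, by simp only [add_sub_cancel_right, inv_smul_smul₀ hc]⟩
      · rintro ⟨y, hy, rfl⟩
        change c • (c⁻¹ • (y - β γ)) + β γ ∈ S'
        rwa [smul_inv_smul₀ hc, sub_add_cancel]
    rw [this]
    exact hS'.isPreconnected.image _ (by fun_prop)
  have hT : GoodExt (fun γ : Γ => lact (γ : SLR n)) (fun γ : Γ => ⇑(ρ γ)) φ T Ψ := by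
    refine ⟨D.isOpen.union (isOpen_iUnion hQ), ⟨⟨0, hST D.zero_mem⟩, ?_⟩, hST D.zero_mem, ?_, ?_,
      ?_, ?_⟩
    · refine isPreconnected_of_forall 0 fun y hy => ?_
      rcases hy with hy | hy
      · exact ⟨S, hST, D.zero_mem, hy, hG.2.1.isPreconnected⟩
      · obtain ⟨γ, hy⟩ := mem_iUnion.1 hy
        obtain ⟨x, hx, hxe⟩ := heγ γ
        exact ⟨S ∪ Q γ, union_subset hST (hQT γ), Or.inl D.zero_mem, Or.inr hy,
          hG.2.1.isPreconnected.union x hx hxe.self_of_nhds.1 (hQpre γ)⟩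
    · intro δ x hx
      rcases hx with hx | hx
      · exact hST (D.lact_mem δ x hx)
      · obtain ⟨γ, hx⟩ := mem_iUnion.1 hx
        exact hQT _ (hQl γ δ x hx)
    · filter_upwards [hG.2.2.2.2.1, D.eventually_mem D.zero_mem] with x h1 h2
      rw [← hΨS h2, h1]
    · intro x hx
      rcases hx with hx | hx
      · exact LocalAnaDiffeoAt.mono (D.diffeo x hx) hΨS hST
      · obtain ⟨γ, hx⟩ := mem_iUnion.1 hx
        exact (LocalAnaDiffeoAt.comp_affine hc (D'.diffeo _ hx)).mono (hΨQ γ) (hQT γ)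
    · intro δ x hx
      rcases hx with hx | hx
      · rw [← hΨS hx, ← hΨS (D.lact_mem δ x hx), D.equivariant δ x hx]
      · obtain ⟨γ, hx⟩ := mem_iUnion.1 hx
        rw [← hΨQ γ hx, ← hΨQ _ (hQl γ δ x hx)]
        simp only [hlact]
        exact D'.equivariant δ _ hx
  have hTS : T = S := hmax T Ψ hT hST
  rintro _ ⟨y, hy, rfl⟩
  have hback : c • (c⁻¹ • (y - β 1)) + β 1 = y := by rw [smul_inv_smul₀ hc, sub_add_cancel]
  have hyQ : c⁻¹ • (y - β 1) ∈ Q 1 := by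
    change c • (c⁻¹ • (y - β 1)) + β 1 ∈ S'
    rwa [hback]
  have hyS : c⁻¹ • (y - β 1) ∈ S := hTS ▸ hQT 1 hyQ
  refine ⟨_, hyS, ?_⟩
  rw [← hSQ 1 _ hyS hyQ, hback]

end

/-- In the Siegel setup, if the Siegel open sets of two fixed points of
the action intersect, they coincide. -/
theorem statement_8 (n : ℕ) (hn : 3 ≤ n) (Γ : Subgroup (SLR n))
    (hlat : IsLatticeIn (SLR n) Γ)
    (M : Type*) [TopologicalSpace M] [T2Space M] [ChartedSpace (V n) M]
    (hM : AnalyticCharts (V n) M)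
    (ρ : Γ →* Equiv.Perm M) (hfaithful : Function.Injective ρ)
    (hρ : ∀ γ : Γ, CAnalytic (V n) (V n) ⇑(ρ γ))
    (x₀ x₁ : M) (φ₀ φ₁ : V n → M) (ℳ₀ ℳ₁ : Set (V n)) (Φ₀ Φ₁ : V n → M)
    (hS₀ : SiegelData Γ ρ x₀ φ₀ ℳ₀ Φ₀)
    (hS₁ : SiegelData Γ ρ x₁ φ₁ ℳ₁ Φ₁)
    (hmeet : (Φ₀ '' ℳ₀ ∩ Φ₁ '' ℳ₁).Nonempty) :
    Φ₀ '' ℳ₀ = Φ₁ '' ℳ₁ := by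
  have hR := hlat.recurrent
  have hG₀ := hS₀.2.2.2.1
  have hG₁ := hS₁.2.2.2.1
  exact Subset.antisymm
    (hS₁.image_subset hn hR hG₀.isDeveloping hG₀.2.1 (by rwa [inter_comm]))
    (hS₀.image_subset hn hR hG₁.isDeveloping hG₁.2.1 hmeet)
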